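/- arXiv:1003.0006 — 3 statements merged into one kernel-verified Lean document; each statement's English description precedes it below -/
import Mathlib

section
/- Let E be a Polish space with its Borel σ-algebra and let ρ : E × E → [0,∞] be a lower semicontinuous metric on E (ρ(x,y) = 0 if and only if x = y, ρ symmetric, ρ satisfying the triangle inequality), not necessarily the metric generating the topology of E. Then for all Borel probability measures μ, ν on E, W_ρ(μ, ν) = sup { ∫ f dμ − ∫ f dν : f : E → ℝ bounded Borel measurable with f(x) − f(y) ≤ ρ(x,y) for all x, y ∈ E }, as an equality in [0,∞]. -/
open MeasureTheory Set Filter Topology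
open scoped ENNReal NNReal

/-- The optimal coupling cost `W_ρ(μ, ν) = inf { ∫ ρ dπ : π a coupling of μ and ν }`. -/
noncomputable def couplingCost {E : Type*} [MeasurableSpace E]
    (ρ : E × E → ENNReal) (μ ν : Measure E) : ENNReal :=
  ⨅ π ∈ {π : Measure (E × E) |
      IsProbabilityMeasure π ∧ π.map Prod.fst = μ ∧ π.map Prod.snd = ν},
    ∫⁻ p, ρ p ∂π

theorem lowerSemicontinuous_biInf_of_isCompact {X Y : Type*} [TopologicalSpace X]
    [TopologicalSpace Y] {F : X × Y → ℝ≥0∞} (hF : LowerSemicontinuous F) {K : Set Y}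
    (hK : IsCompact K) : LowerSemicontinuous fun x ↦ ⨅ y ∈ K, F (x, y) := by
  intro x c hc
  obtain ⟨c', hcc', hc'⟩ := exists_between hc
  obtain ⟨u, v, hu, -, hxu, hKv, huv⟩ := generalized_tube_lemma isCompact_singleton hK
    (hF.isOpen_preimage c') (s := {x}) (by
      rintro ⟨a, b⟩ ⟨rfl, hb⟩
      exact hc'.trans_le (iInf₂_le b hb))
  filter_upwards [hu.mem_nhds (hxu rfl)] with z hz
  exact hcc'.trans_le (le_iInf₂ fun y hy ↦ (huv (mk_mem_prod hz (hKv hy))).le)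

theorem exists_seq_isCompact_ae_mem {E : Type*} [TopologicalSpace E] [PolishSpace E]
    [MeasurableSpace E] [BorelSpace E] (ν : Measure E) [IsFiniteMeasure ν] :
    ∃ K : ℕ → Set E, (∀ n, IsCompact (K n)) ∧ ∀ᵐ x ∂ν, ∃ n, x ∈ K n := by
  choose K hK hKν using fun n : ℕ ↦
    exists_isCompact_closure_measure_compl_lt ν (n + 1 : ℝ≥0∞)⁻¹ (by simp)
  refine ⟨fun n ↦ closure (K n), hK, ?_⟩
  rw [ae_iff]
  refine le_antisymm (le_of_forall_gt fun ε hε ↦ ?_) zero_le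
  obtain ⟨n, hn⟩ := ENNReal.exists_inv_nat_lt hε.ne'
  calc ν {x | ¬ ∃ n, x ∈ closure (K n)} ≤ ν (K n)ᶜ :=
        measure_mono fun x hx hxn ↦ hx ⟨n, subset_closure hxn⟩
    _ < (n + 1 : ℝ≥0∞)⁻¹ := hKν n
    _ ≤ (n : ℝ≥0∞)⁻¹ := by gcongr; exact le_self_add
    _ < ε := hn

/-- The `c`-transform of a continuous potential, taken over a `σ`-compact set carrying `ν`, is Borel
and improves a pair of dual potentials to a single one. -/
theorem exists_lipschitz_potential {E : Type*} [TopologicalSpace E] [PolishSpace E]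
    [MeasurableSpace E] [BorelSpace E] {ρ : E × E → ℝ≥0∞} (hρ_lsc : LowerSemicontinuous ρ)
    (hρ_self : ∀ x, ρ (x, x) = 0) (hρ_tri : ∀ x y z : E, ρ (x, y) ≤ ρ (x, z) + ρ (z, y))
    (μ ν : Measure E) [IsProbabilityMeasure μ] [IsProbabilityMeasure ν] {φ ψ : E → ℝ}
    (hφ : Continuous φ) (hψ : Continuous ψ) {B : ℝ} (hφB : ∀ x, |φ x| ≤ B) (hψB : ∀ x, |ψ x| ≤ B)
    (h : ∀ x y, ENNReal.ofReal (φ x + ψ y) ≤ ρ (x, y)) :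
    ∃ f : E → ℝ, Measurable f ∧ (∃ C : ℝ, ∀ x, |f x| ≤ C) ∧
      (∀ x y, ENNReal.ofReal (f x - f y) ≤ ρ (x, y)) ∧
      ∫ x, φ x ∂μ + ∫ x, ψ x ∂ν ≤ ∫ x, f x ∂μ - ∫ x, f x ∂ν := by
  have hB : 0 ≤ B := (abs_nonneg _).trans (hφB (Classical.choice (nonempty_of_isProbabilityMeasure μ)))
  obtain ⟨K, hK, hKν⟩ := exists_seq_isCompact_ae_mem ν
  let F : E × E → ℝ≥0∞ := fun p ↦ ρ p + ENNReal.ofReal (B - ψ p.2)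
  have hF : LowerSemicontinuous F := hρ_lsc.add (Continuous.lowerSemicontinuous
    (ENNReal.continuous_ofReal.comp (by fun_prop)))
  let g : E → ℝ≥0∞ := fun x ↦ min (ENNReal.ofReal (2 * B)) (⨅ n, ⨅ y ∈ K n, F (x, y))
  have hg : Measurable g := measurable_const.min
    (.iInf fun n ↦ (lowerSemicontinuous_biInf_of_isCompact hF (hK n)).measurable)
  have hgB (x) : g x ≤ ENNReal.ofReal (2 * B) := min_le_left _ _
  have hgtop (x) : g x ≠ ∞ := ne_top_of_le_ne_top ENNReal.ofReal_ne_top (hgB x)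
  have hg_toReal (x) : (g x).toReal ≤ 2 * B := ENNReal.toReal_le_of_le_ofReal (by positivity) (hgB x)
  have hg_lip (x y) : g x ≤ ρ (x, y) + g y := by
    rw [← tsub_le_iff_left]
    refine le_min (tsub_le_self.trans (hgB x)) (le_iInf fun n ↦ le_iInf₂ fun z hz ↦ ?_)
    rw [tsub_le_iff_left, ← add_assoc]
    exact (min_le_right _ _).trans ((iInf_le _ n).trans ((iInf₂_le z hz).trans
      (add_le_add (hρ_tri x z y) le_rfl)))
  have hfB (x) : |(g x).toReal - B| ≤ B := by
    rw [abs_le]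
    constructor <;> linarith [hg_toReal x, ENNReal.toReal_nonneg (a := g x)]
  have hf_meas : Measurable fun x ↦ (g x).toReal - B := hg.ennreal_toReal.sub_const B
  have hf_int (m : Measure E) [IsProbabilityMeasure m] : Integrable (fun x ↦ (g x).toReal - B) m :=
    .of_bound hf_meas.aestronglyMeasurable B (ae_of_all _ hfB)
  refine ⟨fun x ↦ (g x).toReal - B, hf_meas, ⟨B, hfB⟩, fun x y ↦ ?_, ?_⟩
  · rw [sub_sub_sub_cancel_right, ENNReal.ofReal_sub _ ENNReal.toReal_nonneg,
      ENNReal.ofReal_toReal (hgtop x), ENNReal.ofReal_toReal (hgtop y)]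
    exact tsub_le_iff_right.2 (hg_lip x y)
  · have h1 : ∫ x, φ x ∂μ ≤ ∫ x, ((g x).toReal - B) ∂μ := by
      refine integral_mono (.of_bound hφ.aestronglyMeasurable B (ae_of_all _ hφB)) (hf_int μ)
        fun x ↦ ?_
      have := abs_le.1 (hφB x)
      suffices ENNReal.ofReal (φ x + B) ≤ g x by
        linarith [(ENNReal.ofReal_le_iff_le_toReal (hgtop x)).1 this]
      refine le_min (ENNReal.ofReal_le_ofReal (by linarith)) (le_iInf fun n ↦ le_iInf₂ fun y _ ↦ ?_)
      calc ENNReal.ofReal (φ x + B) = ENNReal.ofReal ((φ x + ψ y) + (B - ψ y)) := by congr 1; ring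
        _ ≤ _ := ENNReal.ofReal_add_le.trans (add_le_add (h x y) le_rfl)
    have h2 : ∫ x, ((g x).toReal - B) ∂ν ≤ ∫ x, -ψ x ∂ν := by
      refine integral_mono_ae (hf_int ν)
        (Integrable.of_bound hψ.aestronglyMeasurable B (ae_of_all _ hψB)).neg ?_
      filter_upwards [hKν] with x ⟨n, hn⟩
      have := abs_le.1 (hψB x)
      have hgx : g x ≤ ENNReal.ofReal (B - ψ x) := by
        refine (min_le_right _ _).trans ((iInf_le _ n).trans ((iInf₂_le x hn).trans ?_))
        simp [F, hρ_self]
      linarith [ENNReal.toReal_le_of_le_ofReal (by linarith) hgx]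
    rw [integral_neg] at h2
    linarith

theorem exists_seq_continuousMap_of_lowerSemicontinuous {Y Z : Type*} [TopologicalSpace Y]
    [PseudoEMetricSpace Z] {J : Y → Z} (hJ : IsInducing J) {ρ : Y → ℝ≥0∞}
    (hρ : LowerSemicontinuous ρ) :
    ∃ h : ℕ → C(Z, ℝ), (∀ n z, 0 ≤ h n z) ∧ (∀ y, Monotone fun n ↦ h n (J y)) ∧
      ∀ y, ⨆ n, ENNReal.ofReal (h n (J y)) = ρ y := by
  let g : ℕ → Z → ℝ≥0∞ := fun n z ↦ min n (⨅ y, ρ y + n * edist z (J y))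
  have hg (n) : Continuous (g n) := by
    refine continuous_const.min (continuous_of_le_add_edist n (ENNReal.natCast_ne_top n) ?_)
    intro x z
    rw [ENNReal.iInf_add]
    refine le_iInf fun y ↦ (iInf_le _ y).trans ?_
    rw [add_assoc, ← mul_add, add_comm (edist z _)]
    gcongr
    exact edist_triangle _ _ _
  have hgtop (n z) : g n z ≠ ∞ := ne_top_of_le_ne_top (ENNReal.natCast_ne_top n) (min_le_left _ _)
  have hg_mono (z) : Monotone fun n ↦ g n z := fun m n hmn ↦ by
    dsimp only [g]
    gcongr
  refine ⟨fun n ↦ ⟨fun z ↦ (g n z).toReal, ENNReal.continuousOn_toReal.comp_continuous (hg n)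
    (hgtop n)⟩, fun _ _ ↦ ENNReal.toReal_nonneg, fun y m n hmn ↦
    ENNReal.toReal_mono (hgtop _ _) (hg_mono _ hmn), fun y ↦ ?_⟩
  simp only [ContinuousMap.coe_mk, ENNReal.ofReal_toReal (hgtop _ _)]
  refine le_antisymm (iSup_le fun n ↦ (min_le_right _ _).trans ((iInf_le _ y).trans (by simp)))
    (le_of_forall_lt fun c hc ↦ ?_)
  obtain ⟨c', hcc', hc'⟩ := exists_between hc
  have hc'top : c' ≠ ∞ := hc'.ne_top
  obtain ⟨δ, hδ, hball⟩ := (hJ.basis_nhds Metric.nhds_basis_eball).mem_iff.1 (hρ y c' hc')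
  obtain ⟨n, hn⟩ := ENNReal.exists_nat_gt (r := max c' (c' / δ)) (by
    simp [hc'top, ENNReal.div_eq_top, hδ.ne'])
  have hn' := max_lt_iff.1 hn
  refine hcc'.trans_le (le_iSup_of_le n (le_min hn'.1.le (le_iInf fun y' ↦ ?_)))
  by_cases hy' : edist (J y') (J y) < δ
  · exact le_add_right (hball hy').le
  · rw [edist_comm, not_lt] at hy'
    refine le_add_left ?_
    calc c' ≤ n * δ := by
          rw [← ENNReal.div_le_iff_le_mul (.inl hδ.ne') (.inr (bot_lt_of_lt hn'.1).ne')]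
          exact hn'.2.le
      _ ≤ _ := by gcongr

theorem exists_isFiniteMeasure_integral_eq {X : Type*} [TopologicalSpace X] [CompactSpace X]
    [T2Space X] [MeasurableSpace X] [BorelSpace X] (L : C(X, ℝ) →ₗ[ℝ] ℝ)
    (hL : ∀ h : C(X, ℝ), 0 ≤ h → 0 ≤ L h) :
    ∃ π : Measure X, IsFiniteMeasure π ∧ ∀ h : C(X, ℝ), ∫ x, h x ∂π = L h := by
  let Λ : CompactlySupportedContinuousMap X ℝ →ₚ[ℝ] ℝ := PositiveLinearMap.mk₀
    { toFun := fun h ↦ L h.toContinuousMap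
      map_add' := fun a b ↦ L.map_add a.toContinuousMap b.toContinuousMap
      map_smul' := fun a b ↦ L.map_smul a b.toContinuousMap }
    fun h hh ↦ hL _ hh
  exact ⟨RealRMK.rieszMeasure Λ, inferInstance, fun h ↦
    RealRMK.integral_rieszMeasure Λ (CompactlySupportedContinuousMap.continuousMapEquiv h)⟩

theorem add_integral_le_mul_of_forall_add_le {E : Type*} [TopologicalSpace E] [PolishSpace E]
    [MeasurableSpace E] [BorelSpace E] {ρ : E × E → ℝ≥0∞} (hρ_lsc : LowerSemicontinuous ρ)
    (hρ_self : ∀ x, ρ (x, x) = 0) (hρ_tri : ∀ x y z : E, ρ (x, y) ≤ ρ (x, z) + ρ (z, y))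
    (μ ν : Measure E) [IsProbabilityMeasure μ] [IsProbabilityMeasure ν] {S : ℝ}
    (hS : ∀ f : E → ℝ, Measurable f → (∃ C : ℝ, ∀ x, |f x| ≤ C) →
      (∀ x y, ENNReal.ofReal (f x - f y) ≤ ρ (x, y)) → ∫ x, f x ∂μ - ∫ x, f x ∂ν ≤ S)
    {φ ψ : E → ℝ} (hφ : Continuous φ) (hψ : Continuous ψ) {B : ℝ} (hφB : ∀ x, |φ x| ≤ B)
    (hψB : ∀ x, |ψ x| ≤ B) (t : ℝ≥0) (h : ∀ x y, ENNReal.ofReal (φ x + ψ y) ≤ t * ρ (x, y)) :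
    ∫ x, φ x ∂μ + ∫ x, ψ x ∂ν ≤ t * S := by
  have hφi : Integrable φ μ := .of_bound hφ.aestronglyMeasurable B (ae_of_all _ hφB)
  have hψi : Integrable ψ ν := .of_bound hψ.aestronglyMeasurable B (ae_of_all _ hψB)
  rcases eq_or_ne t 0 with rfl | ht
  · have h' (x y) : φ x + ψ y ≤ 0 := by simpa using h x y
    have h1 (y) : ∫ x, φ x ∂μ ≤ -ψ y := by
      simpa using integral_mono hφi (integrable_const (-ψ y)) fun x ↦ by linarith [h' x y]
    have h2 : ∫ y, ψ y ∂ν ≤ -∫ x, φ x ∂μ := by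
      simpa using integral_mono hψi (integrable_const (-∫ x, φ x ∂μ)) fun y ↦ by linarith [h1 y]
    simp only [NNReal.coe_zero, zero_mul]
    linarith
  · have ht' : (0 : ℝ) < t := NNReal.coe_pos.2 (pos_iff_ne_zero.2 ht)
    have hscale {u : ℝ} (hu : |u| ≤ B) : |(t : ℝ)⁻¹ * u| ≤ (t : ℝ)⁻¹ * B := by
      rw [abs_mul, abs_of_pos (inv_pos.2 ht')]
      gcongr
    obtain ⟨f, hf, hfC, hfρ, hle⟩ := exists_lipschitz_potential hρ_lsc hρ_self hρ_tri μ ν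
      (φ := fun x ↦ (t : ℝ)⁻¹ * φ x) (ψ := fun x ↦ (t : ℝ)⁻¹ * ψ x) (by fun_prop) (by fun_prop)
      (fun x ↦ hscale (hφB x)) (fun x ↦ hscale (hψB x)) fun x y ↦ by
        rw [← mul_add, ENNReal.ofReal_mul (by positivity), ENNReal.ofReal_inv_of_pos ht',
          ENNReal.ofReal_coe_nnreal, mul_comm, ← div_eq_mul_inv]
        exact ENNReal.div_le_of_le_mul' (h x y)
    have := hle.trans (hS f hf hfC hfρ)
    rwa [integral_const_mul, integral_const_mul, ← mul_add, inv_mul_le_iff₀ ht'] at this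

/-- The continuous functions `h` on `X × X` with `h + φ ⊕ ψ + t ρ ≥ 0` along `ι` for some `φ`, `ψ`
and `t ≥ 0` such that `∫ φ dμ + ∫ ψ dν + t S ≤ 0`. -/
def couplingCone {E X : Type*} [MeasurableSpace E] [TopologicalSpace X] (ι : E → X)
    (ρ : E × E → ℝ≥0∞) (μ ν : Measure E) (S : ℝ) : Set C(X × X, ℝ) :=
  {h | ∃ (φ ψ : C(X, ℝ)) (t : ℝ≥0), ∫ x, φ (ι x) ∂μ + ∫ x, ψ (ι x) ∂ν + t * S ≤ 0 ∧
    ∀ x y, ENNReal.ofReal (-(h (ι x, ι y) + φ (ι x) + ψ (ι y))) ≤ t * ρ (x, y)}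

theorem exists_coupling_functional {E X : Type*} [TopologicalSpace E] [PolishSpace E]
    [MeasurableSpace E] [BorelSpace E] [TopologicalSpace X] [CompactSpace X] {ι : E → X}
    (hι : Continuous ι) {ρ : E × E → ℝ≥0∞} (hρ_lsc : LowerSemicontinuous ρ)
    (hρ_self : ∀ x, ρ (x, x) = 0) (hρ_tri : ∀ x y z : E, ρ (x, y) ≤ ρ (x, z) + ρ (z, y))
    (μ ν : Measure E) [IsProbabilityMeasure μ] [IsProbabilityMeasure ν] {S : ℝ}
    (hS : ∀ f : E → ℝ, Measurable f → (∃ C : ℝ, ∀ x, |f x| ≤ C) →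
      (∀ x y, ENNReal.ofReal (f x - f y) ≤ ρ (x, y)) → ∫ x, f x ∂μ - ∫ x, f x ∂ν ≤ S) :
    ∃ L : C(X × X, ℝ) →ₗ[ℝ] ℝ, L 1 = 1 ∧ ∀ h ∈ couplingCone ι ρ μ ν S, 0 ≤ L h := by
  have hbd (φ : C(X, ℝ)) (x : E) : |φ (ι x)| ≤ ‖φ‖ := φ.norm_coe_le_norm (ι x)
  have hint (φ : C(X, ℝ)) (m : Measure E) [IsProbabilityMeasure m] :
      Integrable (fun x ↦ φ (ι x)) m :=
    .of_bound (φ.continuous.comp hι).aestronglyMeasurable ‖φ‖ (ae_of_all _ (hbd φ))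
  have hsmul (c : ℝ≥0) (a : C(X × X, ℝ)) (ha : a ∈ couplingCone ι ρ μ ν S) :
      (c : ℝ) • a ∈ couplingCone ι ρ μ ν S := by
    obtain ⟨φ, ψ, t, hi, h⟩ := ha
    refine ⟨(c : ℝ) • φ, (c : ℝ) • ψ, c * t, ?_, fun x y ↦ ?_⟩
    · simp only [ContinuousMap.smul_apply, smul_eq_mul, NNReal.coe_mul, integral_const_mul]
      nlinarith [c.coe_nonneg]
    · calc ENNReal.ofReal (-(((c : ℝ) • a) (ι x, ι y) + ((c : ℝ) • φ) (ι x) + ((c : ℝ) • ψ) (ι y)))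
          = ENNReal.ofReal (c * -(a (ι x, ι y) + φ (ι x) + ψ (ι y))) := by
            simp only [ContinuousMap.smul_apply, smul_eq_mul]
            ring_nf
        _ = c * ENNReal.ofReal (-(a (ι x, ι y) + φ (ι x) + ψ (ι y))) := by
            rw [ENNReal.ofReal_mul c.coe_nonneg, ENNReal.ofReal_coe_nnreal]
        _ ≤ c * (t * ρ (x, y)) := mul_le_mul_right (h x y) _
        _ = ↑(c * t) * ρ (x, y) := by rw [ENNReal.coe_mul, mul_assoc]
  let s : PointedCone ℝ C(X × X, ℝ) :=
    { carrier := couplingCone ι ρ μ ν S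
      zero_mem' := ⟨0, 0, 0, by simp, by simp⟩
      add_mem' := by
        rintro a b ⟨φ, ψ, t, hi, h⟩ ⟨φ', ψ', t', hi', h'⟩
        refine ⟨φ + φ', ψ + ψ', t + t', ?_, fun x y ↦ ?_⟩
        · simp only [ContinuousMap.add_apply, NNReal.coe_add]
          rw [integral_add (hint _ _) (hint _ _), integral_add (hint _ _) (hint _ _)]
          linarith
        · rw [ENNReal.coe_add, add_mul]
          refine le_trans ?_ (add_le_add (h x y) (h' x y))
          refine le_trans (ENNReal.ofReal_le_ofReal (le_of_eq ?_)) ENNReal.ofReal_add_le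
          simp only [ContinuousMap.add_apply]
          ring
      smul_mem' := fun c a ha ↦ hsmul ⟨c.1, c.2⟩ a ha }
  have hE : Nonempty E := nonempty_of_isProbabilityMeasure μ
  have hX : Nonempty X := hE.map ι
  have h1 : (1 : C(X × X, ℝ)) ≠ 0 := one_ne_zero
  obtain ⟨L, hL, hLs⟩ := riesz_extension s (LinearPMap.mkSpanSingleton (1 : C(X × X, ℝ)) (1 : ℝ) h1)
    (by
      rintro ⟨x, hx⟩ ⟨φ, ψ, t, hi, h⟩
      obtain ⟨a, rfl⟩ := Submodule.mem_span_singleton.1 hx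
      rw [LinearPMap.mkSpanSingleton'_apply]
      have key := add_integral_le_mul_of_forall_add_le hρ_lsc hρ_self hρ_tri μ ν hS
        (φ := fun x ↦ -φ (ι x) - a) (ψ := fun x ↦ -ψ (ι x)) (by fun_prop) (by fun_prop)
        (B := ‖φ‖ + ‖ψ‖ + |a|)
        (fun x ↦ by
          have := abs_sub (-φ (ι x)) a
          rw [abs_neg] at this
          linarith [hbd φ x, norm_nonneg ψ])
        (fun x ↦ by
          rw [abs_neg]
          linarith [hbd ψ x, norm_nonneg φ, abs_nonneg a]) t
        (fun x y ↦ by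
          refine le_trans (ENNReal.ofReal_le_ofReal (le_of_eq ?_)) (h x y)
          simp
          ring)
      rw [integral_sub (f := fun x ↦ -φ (ι x)) (hint _ _).neg (integrable_const a), integral_neg, integral_neg] at key
      simp at key ⊢
      linarith)
    (by
      intro y
      refine ⟨⟨‖y‖ • 1, Submodule.smul_mem _ _ (Submodule.mem_span_singleton_self _)⟩,
        0, 0, 0, by simp, fun a b ↦ ?_⟩
      have := neg_le.1 (neg_le_of_abs_le (y.norm_coe_le_norm (ι a, ι b)))
      simpa using this)
  refine ⟨L, ?_, hLs⟩
  have := hL ⟨1, Submodule.mem_span_singleton_self _⟩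
  exact this.trans (LinearPMap.mkSpanSingleton'_apply_self _ _ _ _)

theorem couplingCost_le_of_forall_lipschitz {E : Type*} [TopologicalSpace E] [PolishSpace E]
    [MeasurableSpace E] [BorelSpace E] {ρ : E × E → ℝ≥0∞} (hρ_lsc : LowerSemicontinuous ρ)
    (hρ_self : ∀ x, ρ (x, x) = 0) (hρ_tri : ∀ x y z : E, ρ (x, y) ≤ ρ (x, z) + ρ (z, y))
    (μ ν : Measure E) [IsProbabilityMeasure μ] [IsProbabilityMeasure ν] :
    couplingCost ρ μ ν ≤
      ⨆ f ∈ {f : E → ℝ | Measurable f ∧ (∃ C : ℝ, ∀ x, |f x| ≤ C) ∧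
          ∀ x y : E, ENNReal.ofReal (f x - f y) ≤ ρ (x, y)},
        ENNReal.ofReal ((∫ x, f x ∂μ) - ∫ x, f x ∂ν) := by
  set S := ⨆ f ∈ {f : E → ℝ | Measurable f ∧ (∃ C : ℝ, ∀ x, |f x| ≤ C) ∧
    ∀ x y : E, ENNReal.ofReal (f x - f y) ≤ ρ (x, y)},
    ENNReal.ofReal ((∫ x, f x ∂μ) - ∫ x, f x ∂ν)
  rcases eq_or_ne S ∞ with hS | hS
  · exact hS ▸ le_top
  have hSle (f : E → ℝ) (hf : Measurable f) (hfC : ∃ C : ℝ, ∀ x, |f x| ≤ C)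
      (hfρ : ∀ x y, ENNReal.ofReal (f x - f y) ≤ ρ (x, y)) :
      ∫ x, f x ∂μ - ∫ x, f x ∂ν ≤ S.toReal :=
    (ENNReal.ofReal_le_iff_le_toReal hS).1 (le_iSup₂_of_le f ⟨hf, hfC, hfρ⟩ le_rfl)
  let := TopologicalSpace.upgradeIsCompletelyMetrizable E
  obtain ⟨ι, hι⟩ := Metric.PiNatEmbed.exists_embedding_to_hilbert_cube (X := E)
  have hιm : MeasurableEmbedding ι := hι.continuous.measurableEmbedding hι.injective
  obtain ⟨L, hL1, hL⟩ := exists_coupling_functional hι.continuous hρ_lsc hρ_self hρ_tri μ ν hSle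
  obtain ⟨π, hπ, hπL⟩ := exists_isFiniteMeasure_integral_eq L fun h hh ↦
    hL h ⟨0, 0, 0, by simp, fun x y ↦ by simpa using hh (ι x, ι y)⟩
  have hfst : π.map Prod.fst = μ.map ι := by
    refine ext_of_forall_integral_eq_of_IsFiniteMeasure fun f ↦ ?_
    rw [integral_map measurable_fst.aemeasurable f.continuous.aestronglyMeasurable,
      integral_map hιm.measurable.aemeasurable f.continuous.aestronglyMeasurable]
    set a := ∫ x, f (ι x) ∂μ with ha
    let h : C((ℕ → unitInterval) × (ℕ → unitInterval), ℝ) := f.toContinuousMap.comp .fst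
    have h1 := hL (h - a • 1) ⟨-f.toContinuousMap, .const _ a, 0,
      by simp [integral_neg, ← ha], fun x y ↦ by simp [h]⟩
    have h2 := hL (a • 1 - h) ⟨f.toContinuousMap, .const _ (-a), 0,
      by simp [← ha], fun x y ↦ by simp [h]⟩
    rw [map_sub, map_smul, hL1, smul_eq_mul, mul_one] at h1 h2
    exact (hπL h).trans (by linarith)
  have hsnd : π.map Prod.snd = ν.map ι := by
    refine ext_of_forall_integral_eq_of_IsFiniteMeasure fun f ↦ ?_
    rw [integral_map measurable_snd.aemeasurable f.continuous.aestronglyMeasurable,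
      integral_map hιm.measurable.aemeasurable f.continuous.aestronglyMeasurable]
    set a := ∫ x, f (ι x) ∂ν with ha
    let h : C((ℕ → unitInterval) × (ℕ → unitInterval), ℝ) := f.toContinuousMap.comp .snd
    have h1 := hL (h - a • 1) ⟨.const _ a, -f.toContinuousMap, 0,
      by simp [integral_neg, ← ha], fun x y ↦ by simp [h]⟩
    have h2 := hL (a • 1 - h) ⟨.const _ (-a), f.toContinuousMap, 0,
      by simp [← ha], fun x y ↦ by simp [h]⟩
    rw [map_sub, map_smul, hL1, smul_eq_mul, mul_one] at h1 h2
    exact (hπL h).trans (by linarith)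
  let J : E × E → (ℕ → unitInterval) × (ℕ → unitInterval) := Prod.map ι ι
  have hJm : MeasurableEmbedding J := hιm.prodMap hιm
  have hJ : IsEmbedding J := hι.prodMap hι
  have hπrange : ∀ᵐ p ∂π, p ∈ range J := by
    have h1 : ∀ᵐ p ∂π, p.1 ∈ range ι := by
      refine ae_of_ae_map measurable_fst.aemeasurable (p := (· ∈ range ι)) ?_
      rw [hfst, ae_map_iff (p := (· ∈ range ι)) hιm.measurable.aemeasurable hιm.measurableSet_range]
      exact ae_of_all _ mem_range_self
    have h2 : ∀ᵐ p ∂π, p.2 ∈ range ι := by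
      refine ae_of_ae_map measurable_snd.aemeasurable (p := (· ∈ range ι)) ?_
      rw [hsnd, ae_map_iff (p := (· ∈ range ι)) hιm.measurable.aemeasurable hιm.measurableSet_range]
      exact ae_of_all _ mem_range_self
    filter_upwards [h1, h2] with p hp1 hp2
    rw [range_prodMap]
    exact ⟨hp1, hp2⟩
  have hmap : (π.comap J).map J = π := by
    rw [hJm.map_comap, Measure.restrict_eq_self_of_ae_mem hπrange]
  have hmarg {m : Measure E} {m' : Measure E} (h : m.map ι = m'.map ι) : m = m' := by
    rw [← hιm.comap_map m, h, hιm.comap_map]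
  have hπfst : (π.comap J).map Prod.fst = μ := by
    refine hmarg ?_
    rw [← hfst, ← hmap, Measure.map_map hιm.measurable measurable_fst,
      Measure.map_map measurable_fst hJm.measurable, hmap]
    rfl
  have hπsnd : (π.comap J).map Prod.snd = ν := by
    refine hmarg ?_
    rw [← hsnd, ← hmap, Measure.map_map hιm.measurable measurable_snd,
      Measure.map_map measurable_snd hJm.measurable, hmap]
    rfl
  have hprob : IsProbabilityMeasure (π.comap J) := by
    rw [← Measure.isProbabilityMeasure_map_iff measurable_fst.aemeasurable, hπfst]
    infer_instance
  refine (iInf₂_le (π.comap J) ⟨hprob, hπfst, hπsnd⟩).trans ?_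
  let : MetricSpace (ℕ → unitInterval) := TopologicalSpace.metrizableSpaceMetric _
  obtain ⟨h, hnn, hmono, hsup⟩ := exists_seq_continuousMap_of_lowerSemicontinuous hJ.isInducing
    hρ_lsc
  simp_rw [← hsup]
  rw [lintegral_iSup (f := fun n p ↦ ENNReal.ofReal (h n (J p)))
    (fun n ↦ ENNReal.measurable_ofReal.comp ((h n).continuous.measurable.comp hJm.measurable))
    fun m n hmn p ↦ ENNReal.ofReal_le_ofReal (hmono p hmn)]
  refine iSup_le fun n ↦ ?_
  rw [← hJm.lintegral_map (fun z ↦ ENNReal.ofReal (h n z)), hmap,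
    ← ofReal_integral_eq_lintegral_ofReal (.of_bound (h n).continuous.aestronglyMeasurable ‖h n‖
      (ae_of_all _ (h n).norm_coe_le_norm)) (ae_of_all _ (hnn n)), hπL,
    ENNReal.ofReal_le_iff_le_toReal hS]
  have := hL (S.toReal • 1 - h n) ⟨.const _ (-S.toReal), 0, 1, by simp, fun x y ↦ by
    simp only [ENNReal.coe_one, one_mul, ← hsup]
    refine le_iSup_of_le n (le_of_eq ?_)
    simp [J]⟩
  rw [map_sub, map_smul, hL1, smul_eq_mul, mul_one] at this
  linarith

theorem stmt_5 {E : Type*} [TopologicalSpace E] [PolishSpace E]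
    [MeasurableSpace E] [BorelSpace E]
    (ρ : E × E → ENNReal) (hρ_lsc : LowerSemicontinuous ρ)
    (hρ_eq : ∀ x y : E, ρ (x, y) = 0 ↔ x = y)
    (hρ_symm : ∀ x y : E, ρ (x, y) = ρ (y, x))
    (hρ_tri : ∀ x y z : E, ρ (x, y) ≤ ρ (x, z) + ρ (z, y))
    (μ ν : Measure E) [IsProbabilityMeasure μ] [IsProbabilityMeasure ν] :
    couplingCost ρ μ ν =
      ⨆ f ∈ {f : E → ℝ | Measurable f ∧ (∃ C : ℝ, ∀ x, |f x| ≤ C) ∧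
          ∀ x y : E, ENNReal.ofReal (f x - f y) ≤ ρ (x, y)},
        ENNReal.ofReal ((∫ x, f x ∂μ) - ∫ x, f x ∂ν) := by
  have hρ_self (x) : ρ (x, x) = 0 := (hρ_eq x x).2 rfl
  refine le_antisymm ?_ ?_
  · exact couplingCost_le_of_forall_lipschitz hρ_lsc hρ_self hρ_tri μ ν
  · refine iSup₂_le fun f ⟨hf, ⟨C, hC⟩, hfρ⟩ ↦ le_iInf₂ fun π ⟨hπ, hπμ, hπν⟩ ↦ ?_
    have hint (m : Measure E) [IsProbabilityMeasure m] : Integrable f m :=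
      .of_bound hf.aestronglyMeasurable C (ae_of_all _ hC)
    have h1 : Integrable (fun p : E × E ↦ f p.1) π :=
      .of_bound (hf.comp measurable_fst).aestronglyMeasurable C (ae_of_all _ fun p ↦ hC p.1)
    have h2 : Integrable (fun p : E × E ↦ f p.2) π :=
      .of_bound (hf.comp measurable_snd).aestronglyMeasurable C (ae_of_all _ fun p ↦ hC p.2)
    rw [← hπμ, ← hπν, integral_map measurable_fst.aemeasurable hf.aestronglyMeasurable,
      integral_map measurable_snd.aemeasurable hf.aestronglyMeasurable, ← integral_sub h1 h2]
    refine (ENNReal.ofReal_le_ofReal (integral_mono (h1.sub h2) (h1.sub h2).pos_part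
      fun p ↦ le_max_left _ _)).trans ?_
    rw [ofReal_integral_eq_lintegral_ofReal (h1.sub h2).pos_part (ae_of_all _ fun p ↦
      le_max_right _ _)]
    refine lintegral_mono fun p ↦ ?_
    simpa [ENNReal.ofReal_max] using hfρ p.1 p.2
end

section
/- Let E be a Polish space with its Borel σ-algebra, let ρ : E × E → [0,∞] be a lower semicontinuous metric on E, and let (κ_t)_{t≥0} be a Markov semigroup on E that acts as a contraction for ρ, i.e., W_ρ(κ_t(x), κ_t(y)) ≤ ρ(x,y) for all t ≥ 0 and x, y ∈ E. Then for all x, y ∈ E and all s, t ≥ 0, W_ρ(κ_{t+s}(x), κ_{t+s}(y)) ≤ W_ρ(κ_t(x), κ_t(y)); that is, t ↦ W_ρ(κ_t(x), κ_t(y)) is nonincreasing. -/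
open MeasureTheory ProbabilityTheory

open Filter Topology TopologicalSpace Set Function
open scoped ENNReal

/-- A measurable map into a separable metrizable space can be approximated pointwise by evaluating
it along countably valued measurable reparametrizations of its domain, which moreover nearly
decrease a given function. -/
lemma exists_countable_reparametrization {Z X : Type*} [MeasurableSpace Z] [Nonempty Z]
    [TopologicalSpace X] [PseudoMetrizableSpace X] [SecondCountableTopology X]
    [MeasurableSpace X] [BorelSpace X] {Φ : Z → X} (hΦ : Measurable Φ) (f : Z → ℝ≥0∞)
    {ε : ℕ → ℝ≥0∞} (hε : ∀ n, ε n ≠ 0) :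
    ∃ (i : ℕ → Z → ℕ) (t : ℕ → ℕ → Z), (∀ n, Measurable (i n)) ∧
      (∀ z, Tendsto (fun n ↦ Φ (t n (i n z))) atTop (𝓝 (Φ z))) ∧
      ∀ n z, f (t n (i n z)) ≤ f z + ε n := by
  let _ := pseudoMetrizableSpacePseudoMetric X
  have hpos (n : ℕ) : (0 : ℝ) < 1 / ((n : ℝ) + 1) := by positivity
  choose A hAm hAb hAd hAu hAdisj using
    fun n : ℕ ↦ SeparableSpace.exists_measurable_partition_diam_le X (hpos n)
  have hex (n : ℕ) (z : Z) : ∃ k, Φ z ∈ A n k := by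
    simpa using (hAu n).symm.subset (mem_univ (Φ z))
  choose i hi using hex
  have hpick (n k : ℕ) : ∃ w : Z, ∀ z, Φ z ∈ A n k → Φ w ∈ A n k ∧ f w ≤ f z + ε n := by
    by_cases hne : (⨅ z ∈ Φ ⁻¹' A n k, f z) = ∞
    · by_cases h : (Φ ⁻¹' A n k).Nonempty
      · obtain ⟨w, hw⟩ := h
        refine ⟨w, fun z hz ↦ ⟨hw, ?_⟩⟩
        simp only [iInf_eq_top] at hne
        simp [hne z hz]
      · exact ⟨Classical.arbitrary Z, fun z hz ↦ (h ⟨z, hz⟩).elim⟩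
    · have hlt := ENNReal.lt_add_right hne (hε n)
      simp only [iInf_lt_iff (a := _ + _)] at hlt
      obtain ⟨w, hw, hlt⟩ := hlt
      exact ⟨w, fun z hz ↦ ⟨hw, hlt.le.trans (by gcongr; exact iInf₂_le z hz)⟩⟩
  choose t ht using hpick
  refine ⟨i, t, fun n ↦ measurable_to_countable' fun k ↦ ?_, fun z ↦ ?_,
    fun n z ↦ (ht n _ z (hi n z)).2⟩
  · have : i n ⁻¹' {k} = Φ ⁻¹' A n k := by
      ext z
      refine ⟨fun h ↦ h ▸ hi n z, fun h ↦ ?_⟩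
      by_contra hne
      exact disjoint_left.1 (hAdisj n hne) (hi n z) h
    exact this ▸ hΦ (hAm n k)
  · rw [tendsto_iff_dist_tendsto_zero]
    exact squeeze_zero (fun _ ↦ dist_nonneg)
      (fun n ↦ (Metric.dist_le_diam_of_mem (hAb n _) (ht n _ z (hi n z)).1 (hi n z)).trans
        (hAd n _)) tendsto_one_div_add_atTop_nhds_zero_nat

/-- Integration of a lower semicontinuous function is lower semicontinuous along weakly convergent
sequences. -/
lemma LowerSemicontinuous.lintegral_le_liminf_of_tendsto {Ω : Type*} [MeasurableSpace Ω]
    [TopologicalSpace Ω] [OpensMeasurableSpace Ω] [HasOuterApproxClosed Ω] {f : Ω → ℝ≥0∞}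
    (hf : LowerSemicontinuous f) {μ : ProbabilityMeasure Ω} {μs : ℕ → ProbabilityMeasure Ω}
    (h : Tendsto μs atTop (𝓝 μ)) :
    ∫⁻ x, f x ∂(μ : Measure Ω) ≤ liminf (fun n ↦ ∫⁻ x, f x ∂(μs n : Measure Ω)) atTop := by
  have hfin (N : ℕ) (x : Ω) : min (f x) N ≠ ∞ := by simp
  have hcake (N : ℕ) (ν : Measure Ω) : ∫⁻ x, min (f x) N ∂ν =
      ∫⁻ s in Ioi (0 : ℝ), ν {x | s < (min (f x) N).toReal} := by
    rw [← lintegral_eq_lintegral_meas_lt ν (ae_of_all _ fun _ ↦ ENNReal.toReal_nonneg)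
      (hf.measurable.min measurable_const).ennreal_toReal.aemeasurable]
    simp [ENNReal.ofReal_toReal, hfin]
  have htrunc (N : ℕ) : ∫⁻ x, min (f x) N ∂(μ : Measure Ω) ≤
      liminf (fun n ↦ ∫⁻ x, f x ∂(μs n : Measure Ω)) atTop := by
    calc ∫⁻ x, min (f x) N ∂(μ : Measure Ω)
        ≤ ∫⁻ s in Ioi (0 : ℝ),
          liminf (fun n ↦ (μs n : Measure Ω) {x | s < (min (f x) N).toReal}) atTop := by
          rw [hcake]
          refine setLIntegral_mono' measurableSet_Ioi fun s hs ↦ ?_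
          refine ProbabilityMeasure.le_liminf_measure_open_of_tendsto h ?_
          have : {x | s < (min (f x) N).toReal} =
              f ⁻¹' Ioi (ENNReal.ofReal s) ∩ {_x | ENNReal.ofReal s < N} := by
            ext x
            rw [mem_ofPred_eq, ← ENNReal.ofReal_lt_iff_lt_toReal (le_of_lt hs) (hfin N x),
              lt_min_iff]
            rfl
          rw [this]
          exact (hf.isOpen_preimage _).inter isOpen_const
      _ ≤ liminf (fun n ↦ ∫⁻ s in Ioi (0 : ℝ),
          (μs n : Measure Ω) {x | s < (min (f x) N).toReal}) atTop :=
          lintegral_liminf_le fun n ↦ Antitone.measurable fun s t hst ↦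
            measure_mono fun x hx ↦ lt_of_le_of_lt hst hx
      _ ≤ _ := by
          refine liminf_le_liminf (Eventually.of_forall fun n ↦ ?_)
          rw [← hcake]
          exact lintegral_mono fun x ↦ min_le_left _ _
  have hsup (x : Ω) : f x = ⨆ N : ℕ, min (f x) N := by
    rw [← inf_iSup_eq, ENNReal.iSup_natCast, inf_top_eq]
  calc ∫⁻ x, f x ∂(μ : Measure Ω) = ∫⁻ x, ⨆ N : ℕ, min (f x) N ∂(μ : Measure Ω) :=
        lintegral_congr hsup
    _ = ⨆ N : ℕ, ∫⁻ x, min (f x) N ∂(μ : Measure Ω) := by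
        refine lintegral_iSup (fun N ↦ hf.measurable.min measurable_const) fun N M hNM x ↦ ?_
        exact min_le_min_left _ (by exact_mod_cast hNM)
    _ ≤ _ := iSup_le htrunc

/-- Weak convergence can be tested on finite unions of elements of a countable basis. -/
lemma ProbabilityMeasure.tendsto_of_tendsto_biUnion_basis {Ω : Type*} [MeasurableSpace Ω]
    [TopologicalSpace Ω] [OpensMeasurableSpace Ω] {b : Set (Set Ω)} (hb : IsTopologicalBasis b)
    (hbc : b.Countable) {μ : ProbabilityMeasure Ω} {μs : ℕ → ProbabilityMeasure Ω}
    (h : ∀ F : Finset b, Tendsto (fun n ↦ (μs n : Measure Ω) (⋃ s ∈ F, (s : Set Ω))) atTop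
      (𝓝 ((μ : Measure Ω) (⋃ s ∈ F, (s : Set Ω))))) :
    Tendsto μs atTop (𝓝 μ) := by
  classical
  have := hbc.to_subtype
  refine tendsto_of_forall_isOpen_le_liminf' fun G hG ↦ ?_
  have hGU : G = ⋃ F ∈ {F : Finset b | ⋃ s ∈ F, (s : Set Ω) ⊆ G}, ⋃ s ∈ F, (s : Set Ω) := by
    refine Subset.antisymm (fun x hx ↦ ?_) (iUnion₂_subset fun F hF ↦ hF)
    obtain ⟨s, hs, hxs, hsG⟩ := hb.exists_subset_of_mem_open hx hG
    exact mem_iUnion₂.2 ⟨{⟨s, hs⟩}, by rwa [mem_ofPred_eq, Finset.set_biUnion_singleton],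
      by rwa [Finset.set_biUnion_singleton]⟩
  have hdir : DirectedOn ((· ⊆ ·) on fun F : Finset b ↦ ⋃ s ∈ F, (s : Set Ω))
      {F : Finset b | ⋃ s ∈ F, (s : Set Ω) ⊆ G} := by
    intro F hF F' hF'
    refine ⟨F ∪ F', ?_, ?_, ?_⟩
    · rw [mem_ofPred_eq, Finset.set_biUnion_union]
      exact union_subset hF hF'
    · exact biUnion_subset_biUnion_left fun s hs ↦ Finset.mem_union_left _ hs
    · exact biUnion_subset_biUnion_left fun s hs ↦ Finset.mem_union_right _ hs
  calc (μ : Measure Ω) G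
      = ⨆ F ∈ {F : Finset b | ⋃ s ∈ F, (s : Set Ω) ⊆ G},
        (μ : Measure Ω) (⋃ s ∈ F, (s : Set Ω)) := by
        rw [← measure_biUnion_eq_iSup (to_countable _) hdir, ← hGU]
    _ ≤ _ := iSup₂_le fun F hF ↦ (h F).liminf_eq.symm.le.trans
        (liminf_le_liminf (Eventually.of_forall fun n ↦ measure_mono hF))

lemma isTightMeasureSet_range_of_tendsto {E : Type*} [TopologicalSpace E] [PolishSpace E]
    [MeasurableSpace E] [BorelSpace E] {μ : ProbabilityMeasure E} {μs : ℕ → ProbabilityMeasure E}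
    (h : Tendsto μs atTop (𝓝 μ)) :
    IsTightMeasureSet {(ν : Measure E) | ν ∈ range μs} := by
  let _ := upgradeIsCompletelyMetrizable E
  refine isTightMeasureSet_of_isCompact_closure ?_
  exact h.isCompact_insert_range.closure_of_subset (subset_insert _ _)

/-- A sequence of couplings with weakly convergent marginals has a weakly convergent subsequence,
and the limit couples the limits of the marginals. -/
lemma exists_subseq_tendsto_coupling {E : Type*} [TopologicalSpace E] [PolishSpace E]
    [MeasurableSpace E] [BorelSpace E] {μ ν : ProbabilityMeasure E}
    {γ : ℕ → ProbabilityMeasure (E × E)}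
    (hμ : Tendsto (fun n ↦ (γ n).map measurable_fst.aemeasurable) atTop (𝓝 μ))
    (hν : Tendsto (fun n ↦ (γ n).map measurable_snd.aemeasurable) atTop (𝓝 ν)) :
    ∃ γ' : ProbabilityMeasure (E × E), (γ' : Measure (E × E)).map Prod.fst = μ ∧
      (γ' : Measure (E × E)).map Prod.snd = ν ∧
      ∃ φ : ℕ → ℕ, StrictMono φ ∧ Tendsto (γ ∘ φ) atTop (𝓝 γ') := by
  let _ := upgradeIsCompletelyMetrizable E
  have htight : IsTightMeasureSet {(ν : Measure (E × E)) | ν ∈ range γ} := by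
    refine IsTightMeasureSet.prodMk ((isTightMeasureSet_range_of_tendsto hμ).subset ?_)
      ((isTightMeasureSet_range_of_tendsto hν).subset ?_)
    · rintro _ ⟨_, ⟨_, ⟨n, rfl⟩, rfl⟩, rfl⟩
      exact ⟨_, ⟨n, rfl⟩, rfl⟩
    · rintro _ ⟨_, ⟨_, ⟨n, rfl⟩, rfl⟩, rfl⟩
      exact ⟨_, ⟨n, rfl⟩, rfl⟩
  obtain ⟨γ', -, φ, hφ, hlim⟩ := (isCompact_closure_of_isTightMeasureSet htight).tendsto_subseq
    fun n ↦ subset_closure (mem_range_self n)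
  refine ⟨γ', ?_, ?_, φ, hφ, hlim⟩
  · exact congrArg ProbabilityMeasure.toMeasure <| tendsto_nhds_unique
      (ProbabilityMeasure.tendsto_map_of_tendsto_of_continuous _ _ hlim continuous_fst)
      (hμ.comp hφ.tendsto_atTop)
  · exact congrArg ProbabilityMeasure.toMeasure <| tendsto_nhds_unique
      (ProbabilityMeasure.tendsto_map_of_tendsto_of_continuous _ _ hlim continuous_snd)
      (hν.comp hφ.tendsto_atTop)

lemma couplingCost_le {E : Type*} [MeasurableSpace E] (ρ : E × E → ℝ≥0∞) {μ ν : Measure E}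
    {π : Measure (E × E)} [IsProbabilityMeasure π] (h₁ : π.map Prod.fst = μ)
    (h₂ : π.map Prod.snd = ν) : couplingCost ρ μ ν ≤ ∫⁻ p, ρ p ∂π :=
  iInf₂_le π ⟨inferInstance, h₁, h₂⟩

lemma exists_coupling_lintegral_le {E : Type*} [MeasurableSpace E] {ρ : E × E → ℝ≥0∞}
    {μ ν : Measure E} [IsProbabilityMeasure μ] [IsProbabilityMeasure ν] {c ε : ℝ≥0∞}
    (h : couplingCost ρ μ ν ≤ c) (hε : ε ≠ 0) :
    ∃ π : Measure (E × E), IsProbabilityMeasure π ∧ π.map Prod.fst = μ ∧ π.map Prod.snd = ν ∧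
      ∫⁻ p, ρ p ∂π ≤ c + ε := by
  by_cases hc : c = ∞
  · exact ⟨μ.prod ν, inferInstance, by simp [Measure.map_fst_prod],
      by simp [Measure.map_snd_prod], by simp [hc]⟩
  · have hlt := h.trans_lt (ENNReal.lt_add_right hc hε)
    simp only [couplingCost, iInf_lt_iff] at hlt
    obtain ⟨π, ⟨h₀, h₁, h₂⟩, hlt⟩ := hlt
    exact ⟨π, h₀, h₁, h₂, hlt.le⟩

/-- Averages of transition probabilities converge weakly if the averaging points are
reparametrized along a sequence for which the transition probabilities of finite unions of basic
open sets converge. -/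
lemma tendsto_probabilityMeasure_bind {E Z : Type*} [TopologicalSpace E]
    [MeasurableSpace E] [OpensMeasurableSpace E] [MeasurableSpace Z]
    {b : Set (Set E)} (hb : IsTopologicalBasis b) (hbc : b.Countable)
    {π : Measure Z} [IsProbabilityMeasure π] {K : ℕ → Z → Measure E} {K' : Z → Measure E}
    (hK : ∀ n, Measurable (K n)) (hK' : Measurable K') (hprob : ∀ n z, IsProbabilityMeasure (K n z))
    {μs : ℕ → ProbabilityMeasure E} {μ : ProbabilityMeasure E}
    (hμs : ∀ n, (μs n : Measure E) = π.bind (K n)) (hμ : (μ : Measure E) = π.bind K')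
    (h : ∀ z, ∀ F : Finset b, Tendsto (fun n ↦ K n z (⋃ s ∈ F, (s : Set E))) atTop
      (𝓝 (K' z (⋃ s ∈ F, (s : Set E))))) :
    Tendsto μs atTop (𝓝 μ) := by
  refine ProbabilityMeasure.tendsto_of_tendsto_biUnion_basis hb hbc fun F ↦ ?_
  have hF : MeasurableSet (⋃ s ∈ F, (s : Set E)) :=
    (isOpen_biUnion fun s _ ↦ hb.isOpen s.2).measurableSet
  simp_rw [hμs, hμ]
  rw [Measure.bind_apply hF hK'.aemeasurable]
  simp_rw [Measure.bind_apply hF (hK _).aemeasurable]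
  exact tendsto_lintegral_of_dominated_convergence (fun _ ↦ 1)
    (fun n ↦ (Measure.measurable_coe hF).comp (hK n))
    (fun n ↦ ae_of_all _ fun z ↦ prob_le_one) (by simp) (ae_of_all _ fun z ↦ h z F)

/-- A Markov kernel which contracts the optimal coupling cost on Dirac masses contracts it on
arbitrary measures. -/
theorem couplingCost_bind_le {E : Type*} [TopologicalSpace E] [PolishSpace E]
    [MeasurableSpace E] [BorelSpace E] {ρ : E × E → ℝ≥0∞} (hρ : LowerSemicontinuous ρ)
    (κ : Kernel E E) [IsMarkovKernel κ] (hκ : ∀ x y, couplingCost ρ (κ x) (κ y) ≤ ρ (x, y))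
    (μ ν : Measure E) :
    couplingCost ρ (μ.bind κ) (ν.bind κ) ≤ couplingCost ρ μ ν := by
  refine le_iInf₂ ?_
  rintro π ⟨hπ, rfl, rfl⟩
  have : Nonempty (E × E) := nonempty_of_isProbabilityMeasure π
  let b := countableBasis E
  have hb : IsTopologicalBasis b := isBasis_countableBasis E
  have hbc : b.Countable := countable_countableBasis E
  have := hbc.to_subtype
  let Φ : E × E → Finset b → ℝ≥0∞ × ℝ≥0∞ :=
    fun z F ↦ (κ z.1 (⋃ s ∈ F, (s : Set E)), κ z.2 (⋃ s ∈ F, (s : Set E)))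
  have hF (F : Finset b) : MeasurableSet (⋃ s ∈ F, (s : Set E)) :=
    (isOpen_biUnion fun s _ ↦ hb.isOpen s.2).measurableSet
  have hΦ : Measurable Φ := measurable_pi_lambda _ fun F ↦
    ((κ.measurable_coe (hF F)).comp measurable_fst).prodMk
      ((κ.measurable_coe (hF F)).comp measurable_snd)
  let ε : ℕ → ℝ≥0∞ := fun n ↦ ((n : ℝ≥0∞))⁻¹
  have hε (n : ℕ) : ε n ≠ 0 := by simp [ε]
  obtain ⟨i, t, hi, ht, hρt⟩ := exists_countable_reparametrization hΦ ρ hε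
  choose g hg h₁ h₂ hgρ using fun n k ↦
    exists_coupling_lintegral_le (hκ (t n k).1 (t n k).2) (hε n)
  have hgm (n : ℕ) : Measurable fun z ↦ g n (i n z) := measurable_from_top.comp (hi n)
  have hγ (n : ℕ) : IsProbabilityMeasure (π.bind fun z ↦ g n (i n z)) :=
    ⟨by simp [Measure.bind_apply MeasurableSet.univ (hgm n).aemeasurable]⟩
  let γ : ℕ → ProbabilityMeasure (E × E) := fun n ↦ ⟨π.bind fun z ↦ g n (i n z), hγ n⟩
  have hmarg {p : E × E → E} (hp : Measurable p) (hgp : ∀ n k, (g n k).map p = κ (p (t n k)))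
      (hconv : ∀ z, ∀ F : Finset b,
        Tendsto (fun n ↦ κ (p (t n (i n z))) (⋃ s ∈ F, (s : Set E))) atTop
          (𝓝 (κ (p z) (⋃ s ∈ F, (s : Set E))))) :
      ∃ μ' : ProbabilityMeasure E, (μ' : Measure E) = (π.map p).bind κ ∧
        Tendsto (fun n ↦ (γ n).map hp.aemeasurable) atTop (𝓝 μ') := by
    have := Measure.isProbabilityMeasure_map (μ := π) hp.aemeasurable
    have hκp : Measurable fun z ↦ κ (p z) := κ.measurable.comp hp
    have hbind : (π.map p).bind κ = π.bind fun z ↦ κ (p z) := by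
      ext s hs
      rw [Measure.bind_apply hs κ.aemeasurable, lintegral_map (κ.measurable_coe hs) hp,
        Measure.bind_apply hs hκp.aemeasurable]
    refine ⟨⟨(π.map p).bind κ, inferInstance⟩, rfl, ?_⟩
    have hKm (n : ℕ) : Measurable fun z ↦ κ (p (t n (i n z))) :=
      (measurable_from_top (f := fun k ↦ κ (p (t n k)))).comp (hi n)
    refine tendsto_probabilityMeasure_bind hb hbc hKm hκp
      (fun n z ↦ inferInstance) (fun n ↦ ?_) hbind hconv
    ext s hs
    change (π.bind fun z ↦ g n (i n z)).map p s = _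
    rw [Measure.map_apply hp hs, Measure.bind_apply (hp hs) (hgm n).aemeasurable,
      Measure.bind_apply hs (hKm n).aemeasurable]
    simp_rw [← hgp, Measure.map_apply hp hs]
  have hΦt (z : E × E) (F : Finset b) := tendsto_pi_nhds.1 (ht z) F
  obtain ⟨μ', hμ', hlim₁⟩ := hmarg measurable_fst h₁
    fun z F ↦ (continuous_fst.tendsto _).comp (hΦt z F)
  obtain ⟨ν', hν', hlim₂⟩ := hmarg measurable_snd h₂
    fun z F ↦ (continuous_snd.tendsto _).comp (hΦt z F)
  obtain ⟨γ', hγ₁, hγ₂, φ, hφ, hlim⟩ := exists_subseq_tendsto_coupling hlim₁ hlim₂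
  have hcost (n : ℕ) : ∫⁻ p, ρ p ∂(γ n : Measure (E × E)) ≤ ∫⁻ p, ρ p ∂π + ε n + ε n := by
    change ∫⁻ p, ρ p ∂(π.bind fun z ↦ g n (i n z)) ≤ _
    calc ∫⁻ p, ρ p ∂(π.bind fun z ↦ g n (i n z))
        ≤ ∫⁻ z, ∫⁻ p, ρ p ∂(g n (i n z)) ∂π := Measure.lintegral_bind_le _ _ _
      _ ≤ ∫⁻ z, ρ z + (ε n + ε n) ∂π := lintegral_mono fun z ↦
          (hgρ n _).trans (by rw [← add_assoc]; gcongr; exact hρt n z)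
      _ = ∫⁻ p, ρ p ∂π + ε n + ε n := by
          rw [lintegral_add_right _ measurable_const]
          simp [add_assoc]
  have hεlim : Tendsto (fun n ↦ ∫⁻ p, ρ p ∂π + ε n + ε n) atTop (𝓝 (∫⁻ p, ρ p ∂π)) := by
    simpa using (tendsto_const_nhds.add ENNReal.tendsto_inv_nat_nhds_zero).add
      ENNReal.tendsto_inv_nat_nhds_zero
  calc couplingCost ρ ((π.map Prod.fst).bind κ) ((π.map Prod.snd).bind κ)
      ≤ ∫⁻ p, ρ p ∂(γ' : Measure (E × E)) :=
        couplingCost_le ρ (hγ₁.trans hμ') (hγ₂.trans hν')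
    _ ≤ liminf (fun n ↦ ∫⁻ p, ρ p ∂((γ ∘ φ) n : Measure (E × E))) atTop :=
        hρ.lintegral_le_liminf_of_tendsto hlim
    _ ≤ liminf (fun n ↦ ∫⁻ p, ρ p ∂π + ε (φ n) + ε (φ n)) atTop :=
        liminf_le_liminf (Eventually.of_forall fun n ↦ hcost (φ n))
    _ = ∫⁻ p, ρ p ∂π := (hεlim.comp hφ.tendsto_atTop).liminf_eq

theorem stmt_8 {E : Type*} [TopologicalSpace E] [PolishSpace E]
    [MeasurableSpace E] [BorelSpace E]
    (ρ : E × E → ENNReal) (hρ_lsc : LowerSemicontinuous ρ)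
    (hρ_eq : ∀ x y : E, ρ (x, y) = 0 ↔ x = y)
    (hρ_symm : ∀ x y : E, ρ (x, y) = ρ (y, x))
    (hρ_tri : ∀ x y z : E, ρ (x, y) ≤ ρ (x, z) + ρ (z, y))
    (κ : ℝ → Kernel E E)
    (hmk : ∀ t : ℝ, 0 ≤ t → IsMarkovKernel (κ t))
    (hsg : ∀ s t : ℝ, 0 ≤ s → 0 ≤ t → ∀ x : E, κ (t + s) x = (κ t x).bind (κ s))
    (hcontr : ∀ t : ℝ, 0 ≤ t → ∀ x y : E, couplingCost ρ (κ t x) (κ t y) ≤ ρ (x, y)) :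
    ∀ x y : E, ∀ s t : ℝ, 0 ≤ s → 0 ≤ t →
      couplingCost ρ (κ (t + s) x) (κ (t + s) y) ≤ couplingCost ρ (κ t x) (κ t y) := by
  intro x y s t hs ht
  have := hmk s hs
  rw [hsg s t hs ht x, hsg s t hs ht y]
  exact couplingCost_bind_le hρ_lsc (κ s) (hcontr s hs) _ _
end

section
/- Let E be a Polish space with its Borel σ-algebra, let ρ : E × E → [0,∞] be a lower semicontinuous metric on E, and let (κ_t)_{t≥0} be a Markov semigroup on E that acts as a contraction for ρ. Assume t ↦ W_ρ(κ_t(x), κ_t(y)) is Borel measurable for each x, y, define h(x,y) := ∫_0^∞ W_ρ(κ_t(x), κ_t(y)) dt, and suppose h(x,y) ≤ M·ρ(x,y) for all x, y ∈ E, where M > 0. Then limsup_{t→∞} (1/t)·log( sup_{x ≠ y} W_ρ(κ_t(x), κ_t(y)) / ρ(x,y) ) ≤ −1/M. -/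
open MeasureTheory ProbabilityTheory Filter

/-- A linear functional dominated by a family of real sets that is closed under addition and
positive scaling. -/
theorem exists_linearMap_le_of_sublinear_sets {V : Type*} [AddCommGroup V] [Module ℝ V]
    (S : V → Set ℝ) (hne : ∀ x, (S x).Nonempty)
    (hadd : ∀ x y, ∀ a ∈ S x, ∀ b ∈ S y, a + b ∈ S (x + y))
    (hsmul : ∀ c : ℝ, 0 < c → ∀ x, ∀ a ∈ S x, c * a ∈ S (c • x))
    (hzero : ∀ a ∈ S 0, 0 ≤ a) :
    ∃ L : V →ₗ[ℝ] ℝ, ∀ x, ∀ a ∈ S x, L x ≤ a := by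
  have hbdd : ∀ x, BddBelow (S x) := by
    intro x
    obtain ⟨b, hb⟩ := hne (-x)
    refine ⟨-b, fun a ha => ?_⟩
    have := hadd x (-x) a ha b hb
    rw [add_neg_cancel] at this
    linarith [hzero _ this]
  have hle : ∀ c : ℝ, 0 < c → ∀ x, sInf (S (c • x)) ≤ c * sInf (S x) := by
    intro c hc x
    rw [← div_le_iff₀' hc]
    refine le_csInf (hne x) fun a ha => ?_
    rw [div_le_iff₀' hc]
    exact csInf_le (hbdd _) (hsmul c hc x a ha)
  obtain ⟨L, -, hL⟩ := exists_extension_of_le_sublinear (⊥ : V →ₗ.[ℝ] ℝ) (fun x => sInf (S x))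
    (fun c hc x => by
      refine le_antisymm (hle c hc x) ?_
      have := hle c⁻¹ (inv_pos.2 hc) (c • x)
      rw [inv_smul_smul₀ hc.ne'] at this
      rwa [← le_inv_mul_iff₀ hc])
    (fun x y => by
      rw [← sub_le_iff_le_add]
      refine le_csInf (hne x) fun a ha => ?_
      rw [sub_le_comm]
      refine le_csInf (hne y) fun b hb => ?_
      linarith [csInf_le (hbdd _) (hadd x y a ha b hb)])
    (fun x => by
      have hx : x = 0 := Subsingleton.elim (α := (⊥ : Submodule ℝ V)) x 0
      rw [hx]
      simpa using Real.sInf_nonneg hzero)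
  exact ⟨L, fun x a ha => (hL x).trans (csInf_le (hbdd x) ha)⟩

/-- A nonnegative lower semicontinuous function is the increasing limit of restrictions of
continuous functions on an ambient metric space. -/
theorem LowerSemicontinuous.exists_monotone_continuousMap_iSup_eq {X K : Type*} [TopologicalSpace X]
    [PseudoMetricSpace K] [Nonempty X] {j : X → K} (hj : Topology.IsInducing j)
    {ρ : X → ENNReal} (hρ : LowerSemicontinuous ρ) :
    ∃ c : ℕ → C(K, ℝ), (∀ n z, 0 ≤ c n z) ∧ Monotone c ∧
      ∀ x, ⨆ n, ENNReal.ofReal (c n (j x)) = ρ x := by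
  have hterm : ∀ (n : ℕ) (z : K) (x : X), 0 ≤ (min (ρ x) n).toReal + n * dist z (j x) :=
    fun n z x => by positivity
  have hbdd : ∀ (n : ℕ) (z : K),
      BddBelow (Set.range fun x => (min (ρ x) n).toReal + n * dist z (j x)) :=
    fun n z => ⟨0, by rintro _ ⟨x, rfl⟩; exact hterm n z x⟩
  have hlip : ∀ n : ℕ, LipschitzWith n
      (fun z => ⨅ x, (min (ρ x) n).toReal + n * dist z (j x)) := by
    intro n
    refine LipschitzWith.of_le_add_mul _ fun z w => ?_
    rw [← sub_le_iff_le_add]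
    refine le_ciInf fun x => ?_
    rw [sub_le_iff_le_add]
    refine (ciInf_le (hbdd n z) x).trans ?_
    have := mul_le_mul_of_nonneg_left (dist_triangle z w (j x)) (Nat.cast_nonneg (α := ℝ) n)
    simp only [NNReal.coe_natCast]
    linarith
  refine ⟨fun n => ⟨_, (hlip n).continuous⟩, fun n z => le_ciInf (hterm n z), ?_, ?_⟩
  · intro m n hmn z
    refine ciInf_mono (hbdd m z) fun x => ?_
    have hmn' : (m : ℝ) ≤ n := by exact_mod_cast hmn
    gcongr
    simp
  · intro x
    refine le_antisymm (iSup_le fun n => ?_) (le_of_forall_lt fun a ha => ?_)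
    · refine ENNReal.ofReal_le_of_le_toReal ?_ |>.trans (min_le_left (ρ x) n)
      refine (ciInf_le (hbdd n (j x)) x).trans ?_
      simp
    · obtain ⟨b, hab, hb⟩ := ENNReal.lt_iff_exists_nnreal_btwn.1 ha
      have hev := hρ x _ hb
      rw [hj.nhds_eq_comap, (Metric.nhds_basis_ball.comap j).eventually_iff] at hev
      obtain ⟨ε, hε, hball⟩ := hev
      obtain ⟨n, hn⟩ := exists_nat_ge (max (b : ℝ) (b / ε))
      refine hab.trans_le (le_iSup_of_le n ?_)
      rw [← ENNReal.ofReal_coe_nnreal]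
      refine ENNReal.ofReal_le_ofReal (le_ciInf fun y => ?_)
      rcases lt_or_ge (dist (j x) (j y)) ε with h | h
      · have hy : (b : ENNReal) < ρ y := hball (by simpa [dist_comm] using h)
        have hbn : (b : ENNReal) ≤ n := by
          have := (le_max_left _ _).trans hn
          exact_mod_cast this
        have : (b : ℝ) ≤ (min (ρ y) n).toReal := by
          simpa using ENNReal.toReal_mono (by simp) (le_min hy.le hbn)
        have := mul_nonneg (Nat.cast_nonneg (α := ℝ) n) (dist_nonneg (x := j x) (y := j y))
        linarith
      · have h1 : (b : ℝ) ≤ n * ε := (div_le_iff₀ hε).1 ((le_max_right _ _).trans hn)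
        have h2 : (n : ℝ) * ε ≤ n * dist (j x) (j y) := by gcongr
        have := ENNReal.toReal_nonneg (a := min (ρ y) n)
        linarith

/-- **Kantorovich duality** on a compact space, for a constraint `ρ` on a subset parametrized by
`u` and `v`. -/
theorem exists_coupling_integral_le_of_compact {X K : Type*} [TopologicalSpace K] [CompactSpace K]
    [T2Space K] [SecondCountableTopology K] [HasOuterApproxClosed K] [MeasurableSpace K]
    [BorelSpace K] {u v : X → K} {ρ : X → ENNReal}
    {μ ν : Measure K} [IsProbabilityMeasure μ] [IsProbabilityMeasure ν] {D : ℝ}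
    (hD : ∀ f g : C(K, ℝ), (∀ x, ENNReal.ofReal (f (u x) + g (v x)) ≤ ρ x) →
      ∫ z, f z ∂μ + ∫ z, g z ∂ν ≤ D) :
    ∃ π : Measure (K × K), IsProbabilityMeasure π ∧ π.map Prod.fst = μ ∧ π.map Prod.snd = ν ∧
      ∀ c : C(K × K, ℝ), (∀ x, ENNReal.ofReal (c (u x, v x)) ≤ ρ x) → ∫ z, c z ∂π ≤ D := by
  have hInt : ∀ (m : Measure K) [IsProbabilityMeasure m] (f : C(K, ℝ)), Integrable f m :=
    fun m _ f => (BoundedContinuousFunction.mkOfCompact f).integrable m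
  have hD' : ∀ s : ℝ, 0 < s → ∀ f g : C(K, ℝ),
      (∀ x, ENNReal.ofReal (f (u x) + g (v x)) ≤ ENNReal.ofReal s * ρ x) →
      ∫ z, f z ∂μ + ∫ z, g z ∂ν ≤ s * D := by
    intro s hs f g h
    have := hD (s⁻¹ • f) (s⁻¹ • g) fun x => by
      have h' := h x
      rw [← ENNReal.inv_mul_le_iff (by simpa using hs) (by simp)] at h'
      rwa [← ENNReal.ofReal_inv_of_pos hs, ← ENNReal.ofReal_mul (by positivity), mul_add] at h'
    simp only [ContinuousMap.coe_smul, Pi.smul_apply, smul_eq_mul, integral_const_mul] at this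
    rwa [← mul_add, inv_mul_le_iff₀ hs] at this
  obtain ⟨L, hL⟩ := exists_linearMap_le_of_sublinear_sets
    (fun F : C(K × K, ℝ) => {r : ℝ | ∃ (f g : C(K, ℝ)) (s : ℝ), 0 < s ∧
      (∀ x, ENNReal.ofReal (F (u x, v x) - f (u x) - g (v x)) ≤ ENNReal.ofReal s * ρ x) ∧
      r = ∫ z, f z ∂μ + ∫ z, g z ∂ν + s * D})
    (fun F => ⟨_, ContinuousMap.const K ‖F‖, 0, 1, one_pos, fun x => by
      have := (le_abs_self _).trans (F.norm_coe_le_norm (u x, v x))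
      rw [ENNReal.ofReal_of_nonpos (by simpa using this)]
      exact zero_le, rfl⟩)
    (by
      rintro F G _ ⟨f, g, s, hs, h, rfl⟩ _ ⟨f', g', s', hs', h', rfl⟩
      refine ⟨f + f', g + g', s + s', by positivity, fun x => ?_, ?_⟩
      · rw [ENNReal.ofReal_add hs.le hs'.le, add_mul]
        refine le_trans (le_of_eq ?_) (ENNReal.ofReal_add_le.trans (add_le_add (h x) (h' x)))
        congr 1
        simp only [ContinuousMap.add_apply]
        ring
      · simp only [ContinuousMap.add_apply]
        rw [integral_add (hInt μ f) (hInt μ f'), integral_add (hInt ν g) (hInt ν g')]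
        ring)
    (by
      rintro c hc F _ ⟨f, g, s, hs, h, rfl⟩
      refine ⟨c • f, c • g, c * s, by positivity, fun x => ?_, ?_⟩
      · rw [ENNReal.ofReal_mul hc.le, mul_assoc]
        refine le_trans (le_of_eq ?_) (mul_le_mul_right (h x) (ENNReal.ofReal c))
        rw [← ENNReal.ofReal_mul hc.le]
        congr 1
        simp only [ContinuousMap.smul_apply, smul_eq_mul]
        ring
      · simp only [ContinuousMap.smul_apply, smul_eq_mul, integral_const_mul]
        ring)
    (by
      rintro _ ⟨f, g, s, hs, h, rfl⟩
      have := hD' s hs (-f) (-g) fun x => by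
        refine le_trans (le_of_eq ?_) (h x)
        congr 1
        simp only [ContinuousMap.neg_apply, ContinuousMap.zero_apply]
        ring
      simp only [ContinuousMap.neg_apply, integral_neg] at this
      linarith)
  have hsplit : ∀ (F : C(K × K, ℝ)) (f g : C(K, ℝ)), (∀ z w, F (z, w) ≤ f z + g w) →
      L F ≤ ∫ z, f z ∂μ + ∫ z, g z ∂ν := by
    intro F f g h
    have key : ∀ s : ℝ, 0 < s → L F ≤ ∫ z, f z ∂μ + ∫ z, g z ∂ν + s * D := fun s hs =>
      hL F _ ⟨f, g, s, hs, fun x => by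
        rw [ENNReal.ofReal_of_nonpos (by linarith [h (u x) (v x)])]
        exact zero_le, rfl⟩
    refine ge_of_tendsto (f := fun s => ∫ z, f z ∂μ + ∫ z, g z ∂ν + s * D)
      (x := nhdsWithin 0 (Set.Ioi 0)) ?_ (eventually_mem_nhdsWithin.mono key)
    have : Continuous fun s : ℝ => ∫ z, f z ∂μ + ∫ z, g z ∂ν + s * D := by fun_prop
    simpa using (this.tendsto 0).mono_left nhdsWithin_le_nhds
  have hpos : ∀ F : C(K × K, ℝ), 0 ≤ F → 0 ≤ L F := by
    intro F hF
    have := hsplit (-F) 0 0 fun z w => by simpa using hF (z, w)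
    simpa using this
  let Λ : CompactlySupportedContinuousMap (K × K) ℝ →ₚ[ℝ] ℝ :=
    { toFun := fun F => L F.toContinuousMap
      map_add' := fun F G => L.map_add F.toContinuousMap G.toContinuousMap
      map_smul' := fun c F => L.map_smul c F.toContinuousMap
      monotone' := fun F G h => by
        have := hpos (G.toContinuousMap - F.toContinuousMap) fun z => sub_nonneg.2 (h z)
        rw [map_sub] at this
        exact sub_nonneg.1 this }
  have hΛ : ∀ F : C(K × K, ℝ), ∫ z, F z ∂(RealRMK.rieszMeasure Λ) = L F := fun F =>
    RealRMK.integral_rieszMeasure Λ ⟨F, HasCompactSupport.of_compactSpace _⟩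
  have hfst : (RealRMK.rieszMeasure Λ).map Prod.fst = μ := by
    refine ext_of_forall_integral_eq_of_IsFiniteMeasure fun f => ?_
    rw [integral_map measurable_fst.aemeasurable f.continuous.aestronglyMeasurable]
    have h0 := hΛ (f.toContinuousMap.comp ContinuousMap.fst)
    have h1 := hsplit (f.toContinuousMap.comp ContinuousMap.fst) f.toContinuousMap 0 (by simp)
    have h2 := hsplit (-f.toContinuousMap.comp ContinuousMap.fst) (-f.toContinuousMap) 0 (by simp)
    simp only [map_neg, ContinuousMap.neg_apply, integral_neg, ContinuousMap.zero_apply,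
      integral_zero, add_zero, neg_le_neg_iff] at h1 h2
    exact h0.trans (le_antisymm h1 h2)
  have hsnd : (RealRMK.rieszMeasure Λ).map Prod.snd = ν := by
    refine ext_of_forall_integral_eq_of_IsFiniteMeasure fun f => ?_
    rw [integral_map measurable_snd.aemeasurable f.continuous.aestronglyMeasurable]
    have h0 := hΛ (f.toContinuousMap.comp ContinuousMap.snd)
    have h1 := hsplit (f.toContinuousMap.comp ContinuousMap.snd) 0 f.toContinuousMap (by simp)
    have h2 := hsplit (-f.toContinuousMap.comp ContinuousMap.snd) 0 (-f.toContinuousMap) (by simp)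
    simp only [map_neg, ContinuousMap.neg_apply, integral_neg, ContinuousMap.zero_apply,
      integral_zero, zero_add, neg_le_neg_iff] at h1 h2
    exact h0.trans (le_antisymm h1 h2)
  refine ⟨RealRMK.rieszMeasure Λ, ⟨?_⟩, hfst, hsnd, fun c hc => ?_⟩
  · have := measure_univ (μ := μ)
    rwa [← hfst, Measure.map_apply measurable_fst .univ, Set.preimage_univ] at this
  · rw [hΛ]
    exact hL c _ ⟨0, 0, 1, one_pos, fun x => by simpa using hc x, by simp⟩

/-- The nontrivial inequality of **Kantorovich duality** for a lower semicontinuous cost. -/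
theorem couplingCost_le_of_forall_dual_le {E : Type*} [TopologicalSpace E] [PolishSpace E]
    [MeasurableSpace E] [BorelSpace E] {ρ : E × E → ENNReal} (hρ : LowerSemicontinuous ρ)
    {μ ν : Measure E} [IsProbabilityMeasure μ] [IsProbabilityMeasure ν] {D : ℝ}
    (hD : ∀ f g : BoundedContinuousFunction E ℝ,
      (∀ x y, ENNReal.ofReal (f x + g y) ≤ ρ (x, y)) → ∫ x, f x ∂μ + ∫ x, g x ∂ν ≤ D) :
    couplingCost ρ μ ν ≤ ENNReal.ofReal D := by
  let := TopologicalSpace.upgradeIsCompletelyMetrizable E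
  let : MetricSpace (ℕ → unitInterval) := TopologicalSpace.metrizableSpaceMetric _
  obtain ⟨j, hj⟩ := Metric.PiNatEmbed.exists_embedding_to_hilbert_cube (X := E)
  have hjm : MeasurableEmbedding j := hj.continuous.measurableEmbedding hj.injective
  have hjj := hj.prodMap hj
  have hjjm : MeasurableEmbedding (Prod.map j j) :=
    hjj.continuous.measurableEmbedding hjj.injective
  have : IsProbabilityMeasure (μ.map j) :=
    Measure.isProbabilityMeasure_map hjm.measurable.aemeasurable
  have : IsProbabilityMeasure (ν.map j) :=
    Measure.isProbabilityMeasure_map hjm.measurable.aemeasurable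
  have : Nonempty E := nonempty_of_isProbabilityMeasure μ
  obtain ⟨π, hπ, hfst, hsnd, hle⟩ := exists_coupling_integral_le_of_compact
    (u := fun p : E × E => j p.1) (v := fun p : E × E => j p.2) (ρ := ρ)
    (μ := μ.map j) (ν := ν.map j) (D := D) (fun f g hfg => by
      rw [hjm.integral_map, hjm.integral_map]
      exact hD ((BoundedContinuousFunction.mkOfCompact f).compContinuous ⟨j, hj.continuous⟩)
        ((BoundedContinuousFunction.mkOfCompact g).compContinuous ⟨j, hj.continuous⟩)
        fun x y => hfg (x, y))
  have hrange : π.restrict (Set.range (Prod.map j j)) = π := by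
    refine Measure.restrict_eq_self_of_ae_mem ?_
    have h1 : ∀ᵐ p ∂π, p.1 ∈ Set.range j := by
      refine ae_of_ae_map measurable_fst.aemeasurable ?_
      rw [hfst]
      exact (hjm.ae_map_iff).2 (.of_forall fun x => ⟨x, rfl⟩)
    have h2 : ∀ᵐ p ∂π, p.2 ∈ Set.range j := by
      refine ae_of_ae_map measurable_snd.aemeasurable ?_
      rw [hsnd]
      exact (hjm.ae_map_iff).2 (.of_forall fun x => ⟨x, rfl⟩)
    filter_upwards [h1, h2] with p hp1 hp2
    rw [Set.range_prodMap]
    exact ⟨hp1, hp2⟩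
  set π' := π.comap (Prod.map j j) with hπ'
  have hmap : π'.map (Prod.map j j) = π := by rw [hjjm.map_comap, hrange]
  have hfst' : π'.map Prod.fst = μ := by
    refine hjm.map_injective ?_
    rw [Measure.map_map hjm.measurable measurable_fst, ← hfst, ← hmap,
      Measure.map_map measurable_fst hjjm.measurable]
    rfl
  have hsnd' : π'.map Prod.snd = ν := by
    refine hjm.map_injective ?_
    rw [Measure.map_map hjm.measurable measurable_snd, ← hsnd, ← hmap,
      Measure.map_map measurable_snd hjjm.measurable]
    rfl
  have hprob : IsProbabilityMeasure π' := by
    constructor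
    have := measure_univ (μ := μ)
    rwa [← hfst', Measure.map_apply measurable_fst .univ, Set.preimage_univ] at this
  obtain ⟨c, hc0, hcm, hc⟩ := hρ.exists_monotone_continuousMap_iSup_eq hjj.isInducing
  refine (iInf₂_le π' ⟨hprob, hfst', hsnd'⟩).trans ?_
  simp_rw [← hc]
  rw [← hjjm.lintegral_map (f := fun p => ⨆ n, ENNReal.ofReal (c n p)), hmap,
    lintegral_iSup (fun n => (c n).continuous.measurable.ennreal_ofReal)
      fun m n hmn p => ENNReal.ofReal_le_ofReal (hcm hmn p)]
  refine iSup_le fun n => ?_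
  have hcint : Integrable (c n) π :=
    (BoundedContinuousFunction.mkOfCompact (c n)).integrable π
  rw [← ofReal_integral_eq_lintegral_ofReal hcint (.of_forall (hc0 n))]
  refine ENNReal.ofReal_le_ofReal (hle (c n) fun p => ?_)
  rw [← hc p]
  exact le_iSup (fun n => ENNReal.ofReal (c n (Prod.map j j p))) n

theorem ofReal_integral_le_lintegral_ofReal {α : Type*} [MeasurableSpace α] {μ : Measure α}
    {f : α → ℝ} (hf : Integrable f μ) :
    ENNReal.ofReal (∫ x, f x ∂μ) ≤ ∫⁻ x, ENNReal.ofReal (f x) ∂μ := by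
  rw [integral_eq_lintegral_pos_part_sub_lintegral_neg_part hf]
  exact (ENNReal.ofReal_le_ofReal (sub_le_self _ ENNReal.toReal_nonneg)).trans
    ENNReal.ofReal_toReal_le

theorem integral_add_integral_eq_of_coupling {E : Type*} [MeasurableSpace E]
    {μ ν : Measure E} {π : Measure (E × E)} (h1 : π.map Prod.fst = μ) (h2 : π.map Prod.snd = ν)
    {f g : E → ℝ} (hf : Integrable f μ) (hg : Integrable g ν) :
    Integrable (fun p : E × E => f p.1 + g p.2) π ∧
      ∫ x, f x ∂μ + ∫ x, g x ∂ν = ∫ p, f p.1 + g p.2 ∂π := by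
  subst h1 h2
  have hf' : Integrable (fun p : E × E => f p.1) π := hf.comp_measurable measurable_fst
  have hg' : Integrable (fun p : E × E => g p.2) π := hg.comp_measurable measurable_snd
  refine ⟨hf'.add hg', ?_⟩
  rw [integral_add hf' hg', integral_map measurable_fst.aemeasurable hf.aestronglyMeasurable,
    integral_map measurable_snd.aemeasurable hg.aestronglyMeasurable]

/-- Weak Kantorovich duality. -/
theorem ofReal_integral_add_integral_le_couplingCost {E : Type*} [MeasurableSpace E]
    {ρ : E × E → ENNReal} {μ ν : Measure E} {f g : E → ℝ} (hf : Integrable f μ)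
    (hg : Integrable g ν) (hfg : ∀ x y, ENNReal.ofReal (f x + g y) ≤ ρ (x, y)) :
    ENNReal.ofReal (∫ x, f x ∂μ + ∫ x, g x ∂ν) ≤ couplingCost ρ μ ν := by
  refine le_iInf₂ fun π ⟨_, h1, h2⟩ => ?_
  obtain ⟨hInt, heq⟩ := integral_add_integral_eq_of_coupling h1 h2 hf hg
  rw [heq]
  exact (ofReal_integral_le_lintegral_ofReal hInt).trans (lintegral_mono fun p => hfg p.1 p.2)

/-- The optimal coupling cost is convex along mixtures: its lower integral against a coupling of
the mixing measures bounds the cost between the mixtures. -/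
theorem couplingCost_bind_le_lintegral {E : Type*} [TopologicalSpace E] [PolishSpace E]
    [MeasurableSpace E] [BorelSpace E] {ρ : E × E → ENNReal} (hρ : LowerSemicontinuous ρ)
    {μ ν : Measure E} [IsProbabilityMeasure μ] [IsProbabilityMeasure ν]
    (η : Kernel E E) [IsMarkovKernel η] {π : Measure (E × E)}
    (h1 : π.map Prod.fst = μ) (h2 : π.map Prod.snd = ν) :
    couplingCost ρ (μ.bind η) (ν.bind η) ≤ ∫⁻ p, couplingCost ρ (η p.1) (η p.2) ∂π := by
  by_cases hD : ∫⁻ p, couplingCost ρ (η p.1) (η p.2) ∂π = ⊤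
  · simp [hD]
  rw [← ENNReal.ofReal_toReal hD]
  refine couplingCost_le_of_forall_dual_le hρ fun f g hfg => ?_
  have hbind : ∀ (m : Measure E) [IsProbabilityMeasure m] (f : BoundedContinuousFunction E ℝ),
      Integrable (fun x => ∫ y, f y ∂η x) m ∧
        ∫ y, f y ∂(m.bind η) = ∫ x, ∫ y, f y ∂η x ∂m := by
    intro m _ f
    have hf : Integrable f ((η ∘ₖ Kernel.const Unit m) ()) := f.integrable _
    have hInt := hf.integral_comp
    have heq := Kernel.integral_comp hf
    rw [Kernel.comp_apply] at heq
    simp only [Kernel.const_apply] at hInt heq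
    exact ⟨hInt, heq⟩
  rw [(hbind μ f).2, (hbind ν g).2]
  obtain ⟨hInt, heq⟩ := integral_add_integral_eq_of_coupling h1 h2 (hbind μ f).1 (hbind ν g).1
  rw [heq, ← ENNReal.ofReal_le_iff_le_toReal hD]
  refine (ofReal_integral_le_lintegral_ofReal hInt).trans (lintegral_mono fun p => ?_)
  exact ofReal_integral_add_integral_le_couplingCost (f.integrable _) (g.integrable _) hfg

/-- A nonincreasing function sampled along an arithmetic progression is bounded by its integral. -/
theorem tsum_mul_le_setLIntegral_Ioi {W : ℝ → ENNReal}
    (hW : ∀ s t : ℝ, 0 ≤ s → s ≤ t → W t ≤ W s) {δ : ℝ} (hδ : 0 < δ) :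
    ∑' k : ℕ, ENNReal.ofReal δ * W ((k + 1) * δ) ≤ ∫⁻ t in Set.Ioi (0 : ℝ), W t := by
  have hmono : Monotone fun k : ℕ => (k : ℝ) * δ := fun m n h => by
    have : (m : ℝ) ≤ n := by exact_mod_cast h
    change (m : ℝ) * δ ≤ n * δ
    gcongr
  have hdisj := hmono.pairwise_disjoint_on_Ioc_succ
  calc ∑' k : ℕ, ENNReal.ofReal δ * W ((k + 1) * δ)
      ≤ ∑' k : ℕ, ∫⁻ t in Set.Ioc ((k : ℝ) * δ) ((Order.succ k : ℕ) * δ), W t := by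
        refine ENNReal.tsum_le_tsum fun k => ?_
        have hk : 0 ≤ (k : ℝ) * δ := by positivity
        have hvol : volume (Set.Ioc ((k : ℝ) * δ) ((Order.succ k : ℕ) * δ)) =
            ENNReal.ofReal δ := by
          rw [Real.volume_Ioc, Nat.succ_eq_succ, Nat.succ_eq_add_one, Nat.cast_add_one]
          congr 1
          ring
        rw [← hvol, mul_comm, ← setLIntegral_const]
        refine setLIntegral_mono' measurableSet_Ioc fun t ht => ?_
        refine hW _ _ (hk.trans ht.1.le) ?_
        simpa using ht.2
    _ = ∫⁻ t in ⋃ k : ℕ, Set.Ioc ((k : ℝ) * δ) ((Order.succ k : ℕ) * δ), W t :=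
        (lintegral_iUnion (fun _ => measurableSet_Ioc) hdisj _).symm
    _ ≤ ∫⁻ t in Set.Ioi (0 : ℝ), W t := by
        refine lintegral_mono_set (Set.iUnion_subset fun k t ht => ?_)
        have hk : 0 ≤ (k : ℝ) * δ := by positivity
        exact hk.trans_lt ht.1

/-- If the tails of a series are dominated by its terms, then the terms decay geometrically. -/
theorem le_geometric_of_tsum_tail_le {w : ℕ → ENNReal} {δ M : ℝ} (hδ : 0 < δ) (hM : 0 < M)
    {B : ENNReal} (h0 : ∑' k, ENNReal.ofReal δ * w k ≤ ENNReal.ofReal M * B)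
    (h : ∀ n, ∑' k, ENNReal.ofReal δ * w (n + 1 + k) ≤ ENNReal.ofReal M * w n) (n : ℕ) :
    w n ≤ ENNReal.ofReal (M / δ * (M / (M + δ)) ^ n) * B := by
  have hpos : 0 < M + δ := by positivity
  have hG : ∀ n, ∑' k, w (n + k) ≤ ENNReal.ofReal (M / δ * (M / (M + δ)) ^ n) * B := by
    intro n
    induction n with
    | zero =>
      rw [ENNReal.tsum_mul_left, ENNReal.mul_le_iff_le_inv (by simpa using hδ) (by simp),
        ← mul_assoc, ← ENNReal.ofReal_inv_of_pos hδ, ← ENNReal.ofReal_mul (by positivity)] at h0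
      simpa [div_eq_inv_mul] using h0
    | succ n ih =>
      have hrec : ∑' k, w (n + k) = w n + ∑' k, w (n + 1 + k) := by
        rw [tsum_eq_zero_add' ENNReal.summable]
        simp only [add_zero]
        congr 2 with k
        congr 1
        ring
      have hle : ENNReal.ofReal (M + δ) * ∑' k, w (n + 1 + k) ≤
          ENNReal.ofReal M * ∑' k, w (n + k) := by
        rw [hrec, ENNReal.ofReal_add hM.le hδ.le, add_mul, mul_add, add_comm]
        rw [← ENNReal.tsum_mul_left]
        exact add_le_add_left (h n) _
      rw [ENNReal.mul_le_iff_le_inv (by simpa using hpos) (by simp),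
        ← ENNReal.ofReal_inv_of_pos hpos] at hle
      refine hle.trans ?_
      refine (mul_le_mul_right (mul_le_mul_right ih _) _).trans (le_of_eq ?_)
      rw [← mul_assoc, ← mul_assoc, ← ENNReal.ofReal_mul (by positivity),
        ← ENNReal.ofReal_mul (by positivity)]
      congr 2
      rw [pow_succ]
      ring
  exact (ENNReal.le_tsum (f := fun k => w (n + k)) 0).trans (hG n)

/-- Geometric decay along a progression interpolates to exponential decay. -/
theorem le_exp_of_le_geometric {W : ℝ → ENNReal}
    (hW : ∀ s t : ℝ, 0 ≤ s → s ≤ t → W t ≤ W s) {δ M : ℝ} (hδ : 0 < δ) (hM : 0 < M) {B : ENNReal}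
    (h : ∀ n : ℕ, W ((n + 1) * δ) ≤ ENNReal.ofReal (M / δ * (M / (M + δ)) ^ n) * B)
    {t : ℝ} (ht : δ ≤ t) :
    W t ≤ ENNReal.ofReal (M / δ * Real.exp ((2 * δ - t) / (M + δ))) * B := by
  have hpos : 0 < M + δ := by positivity
  have h1 : 1 ≤ ⌊t / δ⌋₊ := Nat.le_floor (by simpa using (one_le_div hδ).2 ht)
  obtain ⟨n, hn⟩ := Nat.exists_eq_add_of_le' h1
  have hle : ((n : ℝ) + 1) * δ ≤ t := by
    have := Nat.floor_le (a := t / δ) (div_nonneg (hδ.le.trans ht) hδ.le)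
    rw [hn, le_div_iff₀ hδ] at this
    exact_mod_cast this
  have hlt : t < ((n : ℝ) + 2) * δ := by
    have := Nat.lt_floor_add_one (t / δ)
    rw [hn, div_lt_iff₀ hδ] at this
    push_cast at this
    linarith
  refine ((hW _ _ (by positivity) hle).trans (h n)).trans ?_
  gcongr
  calc (M / (M + δ)) ^ n ≤ Real.exp (-(δ / (M + δ))) ^ n := by
        gcongr
        refine le_of_eq_of_le ?_ (Real.one_sub_le_exp_neg _)
        field_simp
        ring
    _ = Real.exp (-(n * δ) / (M + δ)) := by
        rw [← Real.exp_nat_mul]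
        congr 1
        ring
    _ ≤ _ := by
        gcongr
        linarith

/-- Exponential contraction of the optimal coupling cost along a Markov semigroup with linearly
bounded generalized coupling time. -/
theorem couplingCost_semigroup_le_exp {E : Type*} [TopologicalSpace E] [PolishSpace E]
    [MeasurableSpace E] [BorelSpace E] {ρ : E × E → ENNReal} (hρ : LowerSemicontinuous ρ)
    {κ : ℝ → Kernel E E} (hmk : ∀ t : ℝ, 0 ≤ t → IsMarkovKernel (κ t))
    (hsg : ∀ s t : ℝ, 0 ≤ s → 0 ≤ t → ∀ x : E, κ (t + s) x = (κ t x).bind (κ s))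
    (hcontr : ∀ t : ℝ, 0 ≤ t → ∀ x y : E, couplingCost ρ (κ t x) (κ t y) ≤ ρ (x, y))
    {M : ℝ} (hM : 0 < M)
    (hcoup : ∀ x y : E,
      (∫⁻ t in Set.Ioi (0:ℝ), couplingCost ρ (κ t x) (κ t y)) ≤ ENNReal.ofReal M * ρ (x, y))
    {δ : ℝ} (hδ : 0 < δ) {t : ℝ} (ht : δ ≤ t) (x y : E) :
    couplingCost ρ (κ t x) (κ t y) ≤
      ENNReal.ofReal (M / δ * Real.exp ((2 * δ - t) / (M + δ))) * ρ (x, y) := by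
  have hadd : ∀ s t : ℝ, 0 ≤ s → 0 ≤ t → ∀ (x y : E) (π : Measure (E × E)),
      π.map Prod.fst = κ t x → π.map Prod.snd = κ t y →
      couplingCost ρ (κ (t + s) x) (κ (t + s) y) ≤
        ∫⁻ p, couplingCost ρ (κ s p.1) (κ s p.2) ∂π := by
    intro s t hs ht x y π h1 h2
    have := hmk s hs
    have := hmk t ht
    rw [hsg s t hs ht, hsg s t hs ht]
    exact couplingCost_bind_le_lintegral hρ (κ s) h1 h2
  have hanti : ∀ (x y : E) (s t : ℝ), 0 ≤ s → s ≤ t →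
      couplingCost ρ (κ t x) (κ t y) ≤ couplingCost ρ (κ s x) (κ s y) := by
    intro x y s t hs hst
    refine le_iInf₂ fun π ⟨_, h1, h2⟩ => ?_
    have := hadd (t - s) s (sub_nonneg.2 hst) hs x y π h1 h2
    rw [add_sub_cancel] at this
    exact this.trans (lintegral_mono fun p => hcontr _ (sub_nonneg.2 hst) p.1 p.2)
  have hsum : ∀ x y : E,
      ∑' k : ℕ, ENNReal.ofReal δ * couplingCost ρ (κ ((k + 1) * δ) x) (κ ((k + 1) * δ) y) ≤
        ENNReal.ofReal M * ρ (x, y) := fun x y =>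
    (tsum_mul_le_setLIntegral_Ioi (hanti x y) hδ).trans (hcoup x y)
  refine le_exp_of_le_geometric (hanti x y) hδ hM (le_geometric_of_tsum_tail_le
    (w := fun k : ℕ => couplingCost ρ (κ ((k + 1) * δ) x) (κ ((k + 1) * δ) y))
    hδ hM (hsum x y) fun n => ?_) ht
  rw [← ENNReal.inv_mul_le_iff (by simpa using hM) (by simp)]
  refine le_iInf₂ fun π ⟨_, h1, h2⟩ => ?_
  rw [ENNReal.inv_mul_le_iff (by simpa using hM) (by simp)]
  choose φ hφm hφle hφeq using fun k : ℕ => exists_measurable_le_lintegral_eq π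
    fun p : E × E => couplingCost ρ (κ ((k + 1) * δ) p.1) (κ ((k + 1) * δ) p.2)
  calc ∑' k : ℕ, ENNReal.ofReal δ * couplingCost ρ (κ (((n + 1 + k : ℕ) + 1) * δ) x)
          (κ (((n + 1 + k : ℕ) + 1) * δ) y)
      ≤ ∑' k : ℕ, ENNReal.ofReal δ * ∫⁻ p, φ k p ∂π := by
        refine ENNReal.tsum_le_tsum fun k => mul_le_mul_right ?_ _
        have := hadd ((k + 1) * δ) ((n + 1) * δ) (by positivity) (by positivity) x y π h1 h2
        rw [← hφeq]
        refine le_of_eq_of_le ?_ this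
        congr 3 <;> push_cast <;> ring
    _ = ∫⁻ p, ∑' k : ℕ, ENNReal.ofReal δ * φ k p ∂π := by
        rw [lintegral_tsum fun k => ((hφm k).const_mul _).aemeasurable]
        simp_rw [lintegral_const_mul _ (hφm _)]
    _ ≤ ∫⁻ p, ENNReal.ofReal M * ρ p ∂π :=
        lintegral_mono fun p =>
          (ENNReal.tsum_le_tsum fun k => mul_le_mul_right (hφle k p) _).trans (hsum p.1 p.2)
    _ = ENNReal.ofReal M * ∫⁻ p, ρ p ∂π := lintegral_const_mul' _ _ (by simp)

theorem stmt_12 {E : Type*} [TopologicalSpace E] [PolishSpace E]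
    [MeasurableSpace E] [BorelSpace E]
    (ρ : E × E → ENNReal) (hρ_lsc : LowerSemicontinuous ρ)
    (hρ_eq : ∀ x y : E, ρ (x, y) = 0 ↔ x = y)
    (hρ_symm : ∀ x y : E, ρ (x, y) = ρ (y, x))
    (hρ_tri : ∀ x y z : E, ρ (x, y) ≤ ρ (x, z) + ρ (z, y))
    (κ : ℝ → Kernel E E)
    (hmk : ∀ t : ℝ, 0 ≤ t → IsMarkovKernel (κ t))
    (hsg : ∀ s t : ℝ, 0 ≤ s → 0 ≤ t → ∀ x : E, κ (t + s) x = (κ t x).bind (κ s))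
    (hcontr : ∀ t : ℝ, 0 ≤ t → ∀ x y : E, couplingCost ρ (κ t x) (κ t y) ≤ ρ (x, y))
    (hWmeas : ∀ x y : E, Measurable fun t : ℝ => couplingCost ρ (κ t x) (κ t y))
    (M : ℝ) (hM : 0 < M)
    (hcoup : ∀ x y : E,
      (∫⁻ t in Set.Ioi (0:ℝ), couplingCost ρ (κ t x) (κ t y)) ≤ ENNReal.ofReal M * ρ (x, y)) :
    limsup
      (fun t : ℝ =>
        ((1 / t : ℝ) : EReal) *
          ENNReal.log (⨆ (x : E) (y : E) (_ : x ≠ y),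
            couplingCost ρ (κ t x) (κ t y) / ρ (x, y)))
      atTop ≤ ((-(1 / M) : ℝ) : EReal) := by
  have hrate : ∀ δ : ℝ, 0 < δ → limsup
      (fun t : ℝ =>
        ((1 / t : ℝ) : EReal) *
          ENNReal.log (⨆ (x : E) (y : E) (_ : x ≠ y),
            couplingCost ρ (κ t x) (κ t y) / ρ (x, y)))
      atTop ≤ ((-(1 / (M + δ)) : ℝ) : EReal) := by
    intro δ hδ
    have hlim : Tendsto (fun t : ℝ =>
        (((Real.log (M / δ) + 2 * δ / (M + δ)) / t + -(1 / (M + δ)) : ℝ) : EReal)) atTop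
        (nhds ((-(1 / (M + δ)) : ℝ) : EReal)) := by
      refine (continuous_coe_real_ereal.tendsto _).comp ?_
      simpa using (tendsto_const_nhds.div_atTop tendsto_id).add_const (-(1 / (M + δ)))
    rw [← hlim.limsup_eq]
    refine limsup_le_limsup ?_
    filter_upwards [eventually_ge_atTop δ] with t ht
    have ht0 : 0 < t := hδ.trans_le ht
    have hsup : ⨆ (x : E) (y : E) (_ : x ≠ y), couplingCost ρ (κ t x) (κ t y) / ρ (x, y) ≤
        ENNReal.ofReal (M / δ * Real.exp ((2 * δ - t) / (M + δ))) :=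
      iSup₂_le fun x y => iSup_le fun _ => ENNReal.div_le_of_le_mul
        (couplingCost_semigroup_le_exp hρ_lsc hmk hsg hcontr hM hcoup hδ ht x y)
    refine (mul_le_mul_of_nonneg_left (ENNReal.log_monotone hsup)
      (EReal.coe_nonneg.2 (by positivity))).trans (le_of_eq ?_)
    rw [ENNReal.log_ofReal_of_pos (by positivity), ← EReal.coe_mul,
      Real.log_mul (by positivity) (by positivity), Real.log_exp]
    congr 1
    field_simp
    ring
  refine ge_of_tendsto (f := fun δ : ℝ => ((-(1 / (M + δ)) : ℝ) : EReal))
    (x := nhdsWithin 0 (Set.Ioi 0)) ?_ (eventually_mem_nhdsWithin.mono hrate)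
  refine (continuous_coe_real_ereal.tendsto _).comp (Tendsto.mono_left ?_ nhdsWithin_le_nhds)
  have : ContinuousAt (fun δ : ℝ => -(1 / (M + δ))) 0 := by
    have : M + 0 ≠ 0 := by simpa using hM.ne'
    fun_prop (disch := assumption)
  simpa [ContinuousAt] using this
end
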